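/- Let $F$ be a field with $\operatorname{char} F\neq 2$ and let $\alpha,\beta\in F\setminus\{0,1\}$ with $\alpha\neq\beta$ and $\alpha\notin\{2\beta,4\beta\}$. Let $V$ be a commutative, not necessarily associative or unital, $F$-algebra. For $a\in V$ and $\mu\in F$ put $V_\mu^a=\{x\in V: ax=\mu x\}$. An idempotent $a\in V$ is a primitive axis of Monster type $(\alpha,\beta)$ if $V=V_1^a\oplus V_0^a\oplus V_\alpha^a\oplus V_\beta^a$, $V_1^a=Fa$, and the fusion law holds: $V_1^aV_0^a=0$; $V_1^aV_\mu^a\subseteq V_\mu^a$ and $V_0^aV_\mu^a\subseteq V_\mu^a$ for $\mu\in\{\alpha,\beta\}$; $V_0^aV_0^a\subseteq V_0^a$; $V_\alpha^aV_\alpha^a\subseteq V_1^a+V_0^a$; $V_\alpha^aV_\beta^a\subseteq V_\beta^a$; $V_\beta^aV_\beta^a\subseteq V_1^a+V_0^a+V_\alpha^a$. For such $a$, let $\lambda_a(x)\in F$ denote the coefficient of $a$ in the decomposition $x=\lambda_a(x)a+x_0+x_\alpha+x_\beta$ with $x_\mu\in V_\mu^a$, and let $\tau_a$ (the Miyamoto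 involution, an algebra automorphism) be the linear map that is the identity on $V_1^a+V_0^a+V_\alpha^a$ and $-1$ on $V_\beta^a$. Suppose that $V$ is generated as an algebra by two primitive axes $a_0,a_1$ of Monster type $(\alpha,\beta)$. Let $\rho=\tau_{a_0}\tau_{a_1}$, acting on the right (first $\tau_{a_0}$, then $\tau_{a_1}$), and for $i\in\mathbb Z$ set $a_{2i}=a_0^{\rho^i}$ and $a_{2i+1}=a_1^{\rho^i}$. Put $\lambda_1=\lambda_{a_0}(a_1)$, $\lambda_2=\lambda_{a_0}(a_2)$, $\lambda_1^f=\lambda_{a_1}(a_0)$, $\lambda_2^f=\lambda_{a_1}(a_{-1})$, and $$\begin{aligned} A={}&2\big((\alpha-4\beta)(\alpha^2-4\alpha\beta+\alpha+2\beta)\lambda_1+(3\alpha^3-12\alpha^2\beta-\alpha^2+16\alpha\beta^2+6\alpha\beta-8\beta^2)\lambda_1^f\\ &\quad-(3\alpha^4-14\alpha^3\beta+18\alpha^2\beta^2+2\alpha^2\beta-4\alpha\beta^3-12\alpha\beta^2+8\beta^3)\big)(\lambda_1-\lambda_1^f)\\ &-\alpha\beta(\alpha-\beta)(\alpha-4\beta)(\lambda_2-\lambda_2^f),\\[4pt]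 B={}&\big(2(\alpha^2-2\alpha\beta-\alpha+4\beta)(-3\alpha^2+4\alpha\beta+\alpha-2\beta)(\lambda_1^f)^2-2\alpha(\alpha-1)(\alpha^2-2\alpha\beta-\alpha+4\beta)\lambda_1\lambda_1^f\\ &\quad+(6\alpha^5-24\alpha^4\beta-6\alpha^4+24\alpha^3\beta^2+36\alpha^3\beta+8\alpha^2\beta^3-60\alpha^2\beta^2-4\alpha^2\beta+16\alpha\beta^3+20\alpha\beta^2-16\beta^3)\lambda_1^f\\ &\quad+2\beta(3\alpha^4-16\alpha^3\beta+24\alpha^2\beta^2-\alpha^3+8\alpha^2\beta-24\alpha\beta^2-2\alpha\beta+8\beta^2)\lambda_1\\ &\quad+\alpha\beta(\alpha-\beta)(\alpha^2-2\alpha\beta-\alpha+4\beta)\lambda_2^f\\ &\quad-\beta(6\alpha^5-28\alpha^4\beta+32\alpha^3\beta^2+8\alpha^2\beta^3-2\alpha^4+17\alpha^3\beta-42\alpha^2\beta^2-5\alpha^2\beta+22\alpha\beta^2-8\beta^3)\big)(\lambda_1^f-\lambda_1)\\ &+\beta^2(\alpha-\beta)(\alpha-4\beta)(2\alpha^2-2\alpha\beta-\alpha+2\beta)(\lambda_2-\lambda_2^f).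 \end{aligned}$$ Let $A^f,B^f$ be obtained from $A,B$ by interchanging $\lambda_1\leftrightarrow\lambda_1^f$ and $\lambda_2\leftrightarrow\lambda_2^f$. Then $$A\,(a_{-2}-a_2)=\frac{2}{\beta(\alpha-\beta)}\,B\,(a_{-1}-a_1)\qquad\text{and}\qquad A^f\,(a_3-a_{-1})=\frac{2}{\beta(\alpha-\beta)}\,B^f\,(a_2-a_0).$$ -/

import Mathlib

namespace Axial

section Basic

variable (F : Type*) [Field F] {V : Type*} [NonUnitalNonAssocCommRing V]
  [Module F V] [SMulCommClass F V V] [IsScalarTower F V V]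

/-- The `μ`-eigenspace of the adjoint map `ad_a : x ↦ a * x`. -/
def eigSp (a : V) (μ : F) : Submodule F V where
  carrier := {w | a * w = μ • w}
  add_mem' := by
    intro x y hx hy
    simp only [Set.mem_ofPred_eq] at hx hy ⊢
    rw [mul_add, hx, hy, smul_add]
  zero_mem' := by
    simp only [Set.mem_ofPred_eq, mul_zero, smul_zero]
  smul_mem' := by
    intro c x hx
    simp only [Set.mem_ofPred_eq] at hx ⊢
    rw [mul_smul_comm, hx, smul_comm]

/-- `a` is a primitive axis of Monster type `(α, β)` in the commutative
(not necessarily associative or unital) `F`-algebra `V`. When `1, 0, α, β` are pairwise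
distinct, the sum of the eigenspaces in `decomp` is automatically direct. -/
structure IsAxis (α β : F) (a : V) : Prop where
  idem : a * a = a
  primitive : eigSp F a 1 = Submodule.span F {a}
  decomp : eigSp F a 1 ⊔ eigSp F a 0 ⊔ eigSp F a α ⊔ eigSp F a β = ⊤
  fusion_one_zero : ∀ u ∈ eigSp F a 1, ∀ w ∈ eigSp F a 0, u * w = 0
  fusion_one_alpha : ∀ u ∈ eigSp F a 1, ∀ w ∈ eigSp F a α, u * w ∈ eigSp F a α
  fusion_one_beta : ∀ u ∈ eigSp F a 1, ∀ w ∈ eigSp F a β, u * w ∈ eigSp F a β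
  fusion_zero_zero : ∀ u ∈ eigSp F a 0, ∀ w ∈ eigSp F a 0, u * w ∈ eigSp F a 0
  fusion_zero_alpha : ∀ u ∈ eigSp F a 0, ∀ w ∈ eigSp F a α, u * w ∈ eigSp F a α
  fusion_zero_beta : ∀ u ∈ eigSp F a 0, ∀ w ∈ eigSp F a β, u * w ∈ eigSp F a β
  fusion_alpha_alpha : ∀ u ∈ eigSp F a α, ∀ w ∈ eigSp F a α,
    u * w ∈ eigSp F a 1 ⊔ eigSp F a 0
  fusion_alpha_beta : ∀ u ∈ eigSp F a α, ∀ w ∈ eigSp F a β, u * w ∈ eigSp F a β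
  fusion_beta_beta : ∀ u ∈ eigSp F a β, ∀ w ∈ eigSp F a β,
    u * w ∈ eigSp F a 1 ⊔ eigSp F a 0 ⊔ eigSp F a α

/-- `(V, {a₀, a₁})` is a primitive 2-generated axial algebra of Monster type `(α, β)`. -/
structure IsTwoGenerated (α β : F) (a₀ a₁ : V) : Prop where
  axis₀ : IsAxis F α β a₀
  axis₁ : IsAxis F α β a₁
  generates : NonUnitalAlgebra.adjoin F {a₀, a₁} = ⊤

/-- `τ` is the Miyamoto involution of the axis `a`: the linear map fixing
`V₁ᵃ + V₀ᵃ + V_αᵃ` pointwise and negating `V_βᵃ`. For an axis these two conditions determine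
`τ`; that `τ` preserves products is a consequence of the fusion law and is not assumed. -/
structure IsMiyamoto (α β : F) (a : V) (τ : V ≃ₗ[F] V) : Prop where
  fix_plus : ∀ w ∈ eigSp F a 1 ⊔ eigSp F a 0 ⊔ eigSp F a α, τ w = w
  neg_beta : ∀ w ∈ eigSp F a β, τ w = -w

/-- The bi-infinite sequence of axes `a_j`, with `a_{2i} = a₀^{ρ^i}` and
`a_{2i+1} = a₁^{ρ^i}` where `ρ = τ₀τ₁` (as a right action, `v^ρ = τ₁ (τ₀ v)`). -/
def axSeq (a₀ a₁ : V) (τ₀ τ₁ : V ≃ₗ[F] V) (j : ℤ) : V :=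
  if j % 2 = 0 then ((τ₁ * τ₀) ^ (j / 2)) a₀ else ((τ₁ * τ₀) ^ ((j - 1) / 2)) a₁

/-- `l` is the projection `λ_a(x)` of `x` onto the primitive axis `a`:
`x = l • a + x₀ + x_α + x_β` with `x_μ ∈ V_μ^a`. -/
def HasProj (α β : F) (a x : V) (l : F) : Prop :=
  ∃ v₀ ∈ eigSp F a 0, ∃ vα ∈ eigSp F a α, ∃ vβ ∈ eigSp F a β,
    x = l • a + v₀ + vα + vβ

end Basic

/-- The coefficient `A`, as a function of `α, β, λ₁, λ₁ᶠ, λ₂, λ₂ᶠ`. -/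
def polyA {F : Type*} [Field F] (α β l1 l1f l2 l2f : F) : F :=
  2 * ((α - 4*β) * (α^2 - 4*α*β + α + 2*β) * l1
      + (3*α^3 - 12*α^2*β - α^2 + 16*α*β^2 + 6*α*β - 8*β^2) * l1f
      - (3*α^4 - 14*α^3*β + 18*α^2*β^2 + 2*α^2*β - 4*α*β^3 - 12*α*β^2 + 8*β^3))
    * (l1 - l1f)
  - α*β*(α - β)*(α - 4*β) * (l2 - l2f)

/-- The coefficient `B`, as a function of `α, β, λ₁, λ₁ᶠ, λ₂, λ₂ᶠ`. -/
def polyB {F : Type*} [Field F] (α β l1 l1f l2 l2f : F) : F :=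
  (2*(α^2 - 2*α*β - α + 4*β)*(-3*α^2 + 4*α*β + α - 2*β) * l1f^2
    - 2*α*(α - 1)*(α^2 - 2*α*β - α + 4*β) * l1f * l1
    + (6*α^5 - 24*α^4*β - 6*α^4 + 24*α^3*β^2 + 36*α^3*β + 8*α^2*β^3 - 60*α^2*β^2
        - 4*α^2*β + 16*α*β^3 + 20*α*β^2 - 16*β^3) * l1f
    + 2*β*(3*α^4 - 16*α^3*β + 24*α^2*β^2 - α^3 + 8*α^2*β - 24*α*β^2 - 2*α*β + 8*β^2)
        * l1
    + α*β*(α - β)*(α^2 - 2*α*β - α + 4*β) * l2f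
    - β*(6*α^5 - 28*α^4*β + 32*α^3*β^2 + 8*α^2*β^3 - 2*α^4 + 17*α^3*β - 42*α^2*β^2
        - 5*α^2*β + 22*α*β^2 - 8*β^3)) * (l1f - l1)
  + β^2*(α - β)*(α - 4*β)*(2*α^2 - 2*α*β - α + 2*β) * (l2 - l2f)

end Axial

namespace Axial

section Axis

variable {F : Type*} [Field F] {V : Type*} [NonUnitalNonAssocCommRing V]
  [Module F V] [SMulCommClass F V V]

theorem mem_eigSp {a w : V} {μ : F} : w ∈ eigSp F a μ ↔ a * w = μ • w := Iff.rfl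

/-- For `x = l • a + u + v` with `u ∈ V₀ᵃ`, `v ∈ V_αᵃ`, this is `α • u`. -/
def zeroPart (α : F) (φ : V →ₗ[F] F) (a x : V) : V := α • x - a * x + ((1 - α) * φ x) • a

/-- For `x = l • a + u + v` with `u ∈ V₀ᵃ`, `v ∈ V_αᵃ`, this is `α • v`. -/
def alphaPart (φ : V →ₗ[F] F) (a x : V) : V := a * x - φ x • a

/-- The consequences of the axioms of a nonzero primitive axis `a` that are used below, in terms of
its Miyamoto involution `τ` and the projection `φ` to the coefficient of `a`. -/
structure AxisFrame (α β : F) (a : V) (τ : V ≃ₗ[F] V) (φ : V →ₗ[F] F) : Prop where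
  idem : a * a = a
  tau_mul : ∀ x y, τ (x * y) = τ x * τ y
  mul_sub_tau : ∀ x, a * (x - τ x) = β • (x - τ x)
  phi_self : φ a = 1
  phi_tau : ∀ x, φ (τ x) = φ x
  phi_mul : ∀ x, φ (a * x) = φ x
  mul_mul : ∀ x, τ x = x → a * (a * x) = α • (a * x) + ((1 - α) * φ x) • a
  zero_mul : ∀ x y, τ x = x → τ y = y →
    a * (zeroPart α φ a x * y) = zeroPart α φ a x * alphaPart φ a y
  phi_zero_mul : ∀ x y, τ x = x → τ y = y → φ (zeroPart α φ a x * y) = 0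
  alpha_mul : ∀ x y, τ x = x → τ y = y →
    a * (alphaPart φ a x * y) = zeroPart α φ a y * alphaPart φ a x
      + φ (alphaPart φ a x * y) • a + (φ y * α ^ 2) • alphaPart φ a x

theorem IsAxis.exists_decomp {α β : F} {a : V} (h : IsAxis F α β a) (x : V) :
    ∃ l : F, ∃ u ∈ eigSp F a 0, ∃ v ∈ eigSp F a α, ∃ w ∈ eigSp F a β,
      x = l • a + u + v + w := by
  have hx : x ∈ eigSp F a 1 ⊔ eigSp F a 0 ⊔ eigSp F a α ⊔ eigSp F a β := by
    rw [h.decomp]; exact Submodule.mem_top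
  obtain ⟨y, hy, w, hw, rfl⟩ := Submodule.mem_sup.1 hx
  obtain ⟨z, hz, v, hv, rfl⟩ := Submodule.mem_sup.1 hy
  obtain ⟨o, ho, u, hu, rfl⟩ := Submodule.mem_sup.1 hz
  rw [h.primitive] at ho
  obtain ⟨l, rfl⟩ := Submodule.mem_span_singleton.1 ho
  exact ⟨l, u, hu, v, hv, w, hw, rfl⟩

theorem IsAxis.exists_projection {α β : F} (hα1 : α ≠ 1) (hβ1 : β ≠ 1) {a : V}
    (h : IsAxis F α β a) (ha : a ≠ 0) :
    ∃ φ : V →ₗ[F] F, φ a = 1 ∧ (∀ x ∈ eigSp F a 0, φ x = 0) ∧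
      (∀ x ∈ eigSp F a α, φ x = 0) ∧ (∀ x ∈ eigSp F a β, φ x = 0) := by
  obtain ⟨f, hf⟩ := Module.Projective.exists_dual_eq_one F ha
  let D : V →ₗ[F] V := LinearMap.mulLeft F a
  let φ : V →ₗ[F] F := ((1 - α) * (1 - β))⁻¹ •
    f ∘ₗ (D ∘ₗ D ∘ₗ D - (α + β) • (D ∘ₗ D) + (α * β) • D)
  have key : ∀ (μ : F) (x : V), a * x = μ • x →
      φ x = ((1 - α) * (1 - β))⁻¹ * ((μ * (μ - α) * (μ - β)) * f x) := by
    intro μ x hx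
    have : φ x = ((1 - α) * (1 - β))⁻¹ *
        f (a * (a * (a * x)) - (α + β) • (a * (a * x)) + (α * β) • (a * x)) := rfl
    rw [this]
    simp only [hx, mul_smul_comm, map_add, map_sub, map_smul, smul_eq_mul]
    ring
  have h1 : (1 - α) ≠ 0 := sub_ne_zero.2 hα1.symm
  have h2 : (1 - β) ≠ 0 := sub_ne_zero.2 hβ1.symm
  refine ⟨φ, ?_, fun x hx => ?_, fun x hx => ?_, fun x hx => ?_⟩
  · rw [key 1 a (by rw [h.idem, one_smul]), hf]
    field_simp
  · rw [key 0 x hx]; ring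
  · rw [key α x hx]; ring
  · rw [key β x hx]; ring

/-- The fixed space of the Miyamoto involution of the axis `a`. -/
def plusSp (α : F) (a : V) : Submodule F V := eigSp F a 1 ⊔ eigSp F a 0 ⊔ eigSp F a α

theorem eigSp_one_le_plusSp (α : F) (a : V) : eigSp F a 1 ≤ plusSp α a :=
  le_sup_left.trans le_sup_left

theorem eigSp_zero_le_plusSp (α : F) (a : V) : eigSp F a 0 ≤ plusSp α a :=
  le_sup_right.trans le_sup_left

theorem eigSp_alpha_le_plusSp (α : F) (a : V) : eigSp F a α ≤ plusSp α a := le_sup_right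

theorem IsAxis.mem_plusSp {α β : F} {a p : V} (h : IsAxis F α β a) (hp : p ∈ plusSp α a) :
    ∃ l : F, ∃ u ∈ eigSp F a 0, ∃ v ∈ eigSp F a α, p = l • a + u + v := by
  obtain ⟨z, hz, v, hv, rfl⟩ := Submodule.mem_sup.1 hp
  obtain ⟨o, ho, u, hu, rfl⟩ := Submodule.mem_sup.1 hz
  rw [h.primitive] at ho
  obtain ⟨l, rfl⟩ := Submodule.mem_span_singleton.1 ho
  exact ⟨l, u, hu, v, hv, rfl⟩

theorem IsAxis.exists_plus_beta {α β : F} {a : V} (h : IsAxis F α β a) (x : V) :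
    ∃ p ∈ plusSp α a, ∃ w ∈ eigSp F a β, x = p + w := by
  have hx : x ∈ plusSp α a ⊔ eigSp F a β := by
    rw [plusSp, h.decomp]; exact Submodule.mem_top
  obtain ⟨y, hy, w, hw, rfl⟩ := Submodule.mem_sup.1 hx
  exact ⟨y, hy, w, hw, rfl⟩

theorem IsMiyamoto.apply_add {α β : F} {a p w : V} {τ : V ≃ₗ[F] V} (hτ : IsMiyamoto F α β a τ)
    (hp : p ∈ plusSp α a) (hw : w ∈ eigSp F a β) : τ (p + w) = p - w := by
  rw [map_add, hτ.fix_plus p hp, hτ.neg_beta w hw, sub_eq_add_neg]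

theorem IsMiyamoto.apply_apply {α β : F} {a : V} {τ : V ≃ₗ[F] V} (hτ : IsMiyamoto F α β a τ)
    (h : IsAxis F α β a) (x : V) : τ (τ x) = x := by
  obtain ⟨p, hp, w, hw, rfl⟩ := h.exists_plus_beta x
  rw [hτ.apply_add hp hw, map_sub, hτ.fix_plus p hp, hτ.neg_beta w hw, sub_neg_eq_add]

theorem IsMiyamoto.apply_self {α β : F} {a : V} {τ : V ≃ₗ[F] V} (hτ : IsMiyamoto F α β a τ)
    (h : IsAxis F α β a) : τ a = a :=
  hτ.fix_plus a (eigSp_one_le_plusSp α a (by rw [mem_eigSp, h.idem, one_smul]))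

theorem IsMiyamoto.apply_of_eq_zero {α β : F} {a : V} {τ : V ≃ₗ[F] V}
    (hτ : IsMiyamoto F α β a τ) (ha : a = 0) (x : V) : τ x = x :=
  hτ.fix_plus x (eigSp_zero_le_plusSp α a (by rw [mem_eigSp, ha, zero_mul, zero_smul]))

theorem IsMiyamoto.exists_of_fixed {α β : F} (hchar : (2 : F) ≠ 0) {a : V} {τ : V ≃ₗ[F] V}
    (h : IsAxis F α β a) (hτ : IsMiyamoto F α β a τ) {x : V} (hx : τ x = x) :
    ∃ l : F, ∃ u ∈ eigSp F a 0, ∃ v ∈ eigSp F a α, x = l • a + u + v := by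
  obtain ⟨p, hp, w, hw, rfl⟩ := h.exists_plus_beta x
  rw [hτ.apply_add hp hw] at hx
  have h2 : (2 : F) • w = 0 := by linear_combination (norm := module) -(1 : F) • hx
  rw [(smul_eq_zero.1 h2).resolve_left hchar, add_zero]
  exact h.mem_plusSp hp

variable [IsScalarTower F V V]

theorem IsAxis.mul_mem_plusSp {α β : F} {a p q : V} (h : IsAxis F α β a)
    (hp : p ∈ plusSp α a) (hq : q ∈ plusSp α a) : p * q ∈ plusSp α a := by
  have haq : ∀ q ∈ plusSp α a, a * q ∈ plusSp α a := by
    intro q hq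
    obtain ⟨l, u, hu, v, hv, rfl⟩ := h.mem_plusSp hq
    have : a * (l • a + u + v) = l • a + α • v := by
      rw [mul_add, mul_add, mul_smul_comm, h.idem, hu, hv, zero_smul, add_zero]
    rw [this]
    refine Submodule.add_mem _ (Submodule.smul_mem _ _ (eigSp_one_le_plusSp α a ?_))
      (Submodule.smul_mem _ _ (eigSp_alpha_le_plusSp α a hv))
    rw [mem_eigSp, h.idem, one_smul]
  have hsum : eigSp F a 1 ⊔ eigSp F a 0 ≤ plusSp α a := le_sup_left
  have hp' := hp
  have hq' := hq
  obtain ⟨l, u, hu, v, hv, rfl⟩ := h.mem_plusSp hp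
  obtain ⟨m, u', hu', v', hv', rfl⟩ := h.mem_plusSp hq
  have e : (l • a + u + v) * (m • a + u' + v')
      = l • (a * (m • a + u' + v')) + m • (a * (u + v)) + u * u' + u * v' + u' * v + v * v' := by
    simp only [add_mul, mul_add, smul_mul_assoc, mul_smul_comm, mul_comm u a, mul_comm v a,
      mul_comm v u']
    module
  rw [e]
  refine Submodule.add_mem _ (Submodule.add_mem _ (Submodule.add_mem _ (Submodule.add_mem _
    (Submodule.add_mem _ (Submodule.smul_mem _ _ (haq _ hq')) (Submodule.smul_mem _ _ (haq _ ?_)))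
    ?_) ?_) ?_) ?_
  · exact Submodule.add_mem _ (eigSp_zero_le_plusSp α a hu) (eigSp_alpha_le_plusSp α a hv)
  · exact eigSp_zero_le_plusSp α a (h.fusion_zero_zero _ hu _ hu')
  · exact eigSp_alpha_le_plusSp α a (h.fusion_zero_alpha _ hu _ hv')
  · exact eigSp_alpha_le_plusSp α a (h.fusion_zero_alpha _ hu' _ hv)
  · exact hsum (h.fusion_alpha_alpha _ hv _ hv')

theorem IsAxis.plusSp_mul_beta {α β : F} {a p w : V} (h : IsAxis F α β a)
    (hp : p ∈ plusSp α a) (hw : w ∈ eigSp F a β) : p * w ∈ eigSp F a β := by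
  obtain ⟨l, u, hu, v, hv, rfl⟩ := h.mem_plusSp hp
  rw [add_mul, add_mul, smul_mul_assoc, mem_eigSp.1 hw]
  exact Submodule.add_mem _ (Submodule.add_mem _
    (Submodule.smul_mem _ _ (Submodule.smul_mem _ _ hw)) (h.fusion_zero_beta _ hu _ hw))
    (h.fusion_alpha_beta _ hv _ hw)

theorem IsMiyamoto.map_mul {α β : F} {a : V} {τ : V ≃ₗ[F] V} (h : IsAxis F α β a)
    (hτ : IsMiyamoto F α β a τ) (x y : V) : τ (x * y) = τ x * τ y := by
  obtain ⟨p, hp, w, hw, rfl⟩ := h.exists_plus_beta x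
  obtain ⟨q, hq, z, hz, rfl⟩ := h.exists_plus_beta y
  have e : (p + w) * (q + z) = (p * q + w * z) + (p * z + q * w) := by
    rw [add_mul, mul_add, mul_add, mul_comm w q]; abel
  rw [e, hτ.apply_add (Submodule.add_mem _ (h.mul_mem_plusSp hp hq) (h.fusion_beta_beta _ hw _ hz))
    (Submodule.add_mem _ (h.plusSp_mul_beta hp hz) (h.plusSp_mul_beta hq hw)),
    hτ.apply_add hp hw, hτ.apply_add hq hz, sub_mul, mul_sub, mul_sub, mul_comm w q]
  abel

theorem IsAxis.exists_frame {α β : F} (hchar : (2 : F) ≠ 0) (hα1 : α ≠ 1) (hβ1 : β ≠ 1)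
    {a : V} {τ : V ≃ₗ[F] V} (h : IsAxis F α β a) (hτ : IsMiyamoto F α β a τ) (ha : a ≠ 0) :
    ∃ φ : V →ₗ[F] F, AxisFrame α β a τ φ ∧ ∀ x l, HasProj F α β a x l → φ x = l := by
  obtain ⟨φ, h1, h0, hα, hβ⟩ := h.exists_projection hα1 hβ1 ha
  have proj : ∀ x l, HasProj F α β a x l → φ x = l := by
    rintro x l ⟨u, hu, v, hv, w, hw, rfl⟩
    simp [h1, h0 u hu, hα v hv, hβ w hw]
  have zp : ∀ (l : F) (u v : V), u ∈ eigSp F a 0 → v ∈ eigSp F a α →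
      zeroPart α φ a (l • a + u + v) = α • u := by
    intro l u v hu hv
    have : φ (l • a + u + v) = l := by simp [h1, h0 u hu, hα v hv]
    rw [zeroPart, this, mul_add, mul_add, mul_smul_comm, h.idem, mem_eigSp.1 hu, mem_eigSp.1 hv]
    module
  have ap : ∀ (l : F) (u v : V), u ∈ eigSp F a 0 → v ∈ eigSp F a α →
      alphaPart φ a (l • a + u + v) = α • v := by
    intro l u v hu hv
    have : φ (l • a + u + v) = l := by simp [h1, h0 u hu, hα v hv]
    rw [alphaPart, this, mul_add, mul_add, mul_smul_comm, h.idem, mem_eigSp.1 hu, mem_eigSp.1 hv]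
    module
  have even := fun {x : V} (hx : τ x = x) => hτ.exists_of_fixed hchar h hx
  have phi_mul : ∀ x, φ (a * x) = φ x := by
    intro x
    obtain ⟨l, u, hu, v, hv, w, hw, rfl⟩ := h.exists_decomp x
    simp only [mul_add, mul_smul_comm, h.idem, mem_eigSp.1 hu, mem_eigSp.1 hv, mem_eigSp.1 hw,
      map_add, map_smul, h0 u hu, hα v hv, hβ w hw, smul_zero]
  refine ⟨φ, ⟨h.idem, hτ.map_mul h, ?_, h1, ?_, phi_mul, ?_, ?_, ?_, ?_⟩, proj⟩
  · intro x
    obtain ⟨p, hp, w, hw, rfl⟩ := h.exists_plus_beta x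
    have e : p + w - (p - w) = (2 : F) • w := by module
    rw [hτ.apply_add hp hw, e, mul_smul_comm, mem_eigSp.1 hw, smul_comm]
  · intro x
    obtain ⟨p, hp, w, hw, rfl⟩ := h.exists_plus_beta x
    rw [hτ.apply_add hp hw, map_sub, map_add, hβ w hw, sub_zero, add_zero]
  · intro x hx
    obtain ⟨l, u, hu, v, hv, rfl⟩ := even hx
    have : φ (l • a + u + v) = l := by simp [h1, h0 u hu, hα v hv]
    simp only [this, mul_add, mul_smul_comm, h.idem, mem_eigSp.1 hu, mem_eigSp.1 hv]
    module
  · intro x y hx hy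
    obtain ⟨l, u, hu, v, hv, rfl⟩ := even hx
    obtain ⟨m, u', hu', v', hv', rfl⟩ := even hy
    rw [zp l u v hu hv, ap m u' v' hu' hv']
    have e1 := mem_eigSp.1 (h.fusion_zero_zero _ hu _ hu')
    have e2 := mem_eigSp.1 (h.fusion_zero_alpha _ hu _ hv')
    simp only [smul_mul_assoc, mul_smul_comm, mul_add, mul_comm u a, mem_eigSp.1 hu, e1, e2]
    module
  · intro x y hx hy
    obtain ⟨l, u, hu, v, hv, rfl⟩ := even hx
    obtain ⟨m, u', hu', v', hv', rfl⟩ := even hy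
    rw [zp l u v hu hv]
    have e1 := h0 _ (h.fusion_zero_zero _ hu _ hu')
    have e2 := hα _ (h.fusion_zero_alpha _ hu _ hv')
    simp only [smul_mul_assoc, mul_smul_comm, mul_add, mul_comm u a, mem_eigSp.1 hu, map_add,
      map_smul, e1, e2, map_zero, zero_smul, smul_zero, add_zero]
  · intro x y hx hy
    obtain ⟨l, u, hu, v, hv, rfl⟩ := even hx
    obtain ⟨m, u', hu', v', hv', rfl⟩ := even hy
    have hφ : φ (m • a + u' + v') = m := by simp [h1, h0 u' hu', hα v' hv']
    rw [zp m u' v' hu' hv', ap l u v hu hv, hφ]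
    have e2 := mem_eigSp.1 (h.fusion_zero_alpha _ hu' _ hv)
    have e2' := hα _ (h.fusion_zero_alpha _ hu' _ hv)
    obtain ⟨o, ho, t, ht, e3⟩ := Submodule.mem_sup.1 (h.fusion_alpha_alpha _ hv _ hv')
    rw [h.primitive] at ho
    obtain ⟨c, rfl⟩ := Submodule.mem_span_singleton.1 ho
    simp only [smul_mul_assoc, mul_smul_comm, mul_add, mul_comm v a, mul_comm v u',
      mem_eigSp.1 hv, e2, e2', ← e3, h.idem, mem_eigSp.1 ht, map_add, map_smul, h1, h0 t ht,
      hα v hv, smul_eq_mul]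
    match_scalars <;> ring

end Axis
end Axial

namespace Axial

section Products

variable {F : Type*} [Field F] {V : Type*} [NonUnitalNonAssocCommRing V]
  [Module F V] {α β : F} {a : V} {τ : V ≃ₗ[F] V} {φ : V →ₗ[F] F}

theorem zeroPart_eq {b s : V} {l : F} (hφ : φ b = 2 * l)
    (hab : a * b = (2 : F) • s + (2 * β) • a + β • b) :
    zeroPart α φ a b = (α - β) • b - (2 : F) • s + (2 * (1 - α) * l - 2 * β) • a := by
  rw [zeroPart, hφ, hab]; module

theorem alphaPart_eq {b s : V} {l : F} (hφ : φ b = 2 * l)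
    (hab : a * b = (2 : F) • s + (2 * β) • a + β • b) :
    alphaPart φ a b = (2 : F) • s + (2 * β - 2 * l) • a + β • b := by
  rw [alphaPart, hφ, hab]; module

theorem AxisFrame.phi_s (h : AxisFrame α β a τ φ) (hchar : (2 : F) ≠ 0) {b s : V} {l : F}
    (hφ : φ b = 2 * l) (hab : a * b = (2 : F) • s + (2 * β) • a + β • b) :
    φ s = l - β - β * l := by
  have e := h.phi_mul b
  rw [hab] at e
  simp only [map_add, map_smul, hφ, h.phi_self, smul_eq_mul] at e
  exact mul_left_cancel₀ hchar (by linear_combination e)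

variable [SMulCommClass F V V]

theorem AxisFrame.mul_s (h : AxisFrame α β a τ φ) (hchar : (2 : F) ≠ 0) {b s : V} {l : F}
    (hb : τ b = b) (hφ : φ b = 2 * l) (hab : a * b = (2 : F) • s + (2 * β) • a + β • b) :
    a * s = (l - β - β * l + (α - β) * (β - l)) • a + ((α - β) * β / 2) • b + (α - β) • s := by
  have e := h.mul_mul b hb
  rw [hφ, hab] at e
  simp only [mul_add, mul_smul_comm, h.idem, hab] at e
  linear_combination (norm := skip) (1 / 2 : F) • e
  match_scalars <;> field_simp <;> ring

theorem AxisFrame.zeroPart_mul_self (h : AxisFrame α β a τ φ) {x : V} (hx : τ x = x) :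
    zeroPart α φ a x * a = 0 := by
  rw [zeroPart, mul_comm]
  simp only [mul_add, mul_sub, mul_smul_comm, h.mul_mul x hx, h.idem]
  module

theorem AxisFrame.mul_commutator (h : AxisFrame α β a τ φ) {x y : V} (hx : τ x = x)
    (hy : τ y = y) :
    a * (zeroPart α φ a x * y - zeroPart α φ a y * x)
      = α • (zeroPart α φ a x * y - zeroPart α φ a y * x) := by
  have split : ∀ z, α • z = zeroPart α φ a z + alphaPart φ a z + (α * φ z) • a := by
    intro z; rw [zeroPart, alphaPart]; module
  rw [smul_sub, ← mul_smul_comm, ← mul_smul_comm, split y, split x, mul_sub,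
    h.zero_mul x y hx hy, h.zero_mul y x hy hx]
  simp only [mul_add, mul_smul_comm, h.zeroPart_mul_self hx, h.zeroPart_mul_self hy,
    mul_comm (zeroPart α φ a y) (zeroPart α φ a x)]
  module

/-- The coefficient of `a₀` in `a₀ * s₁₂` where `s₁₂ = a₁ * a₋₁ - β • (a₁ + a₋₁)`. -/
def coefA (α β l1 m1 l2 : F) : F :=
  (4*α^3*β - 4*α^3*l1 - 4*α^2*β^2 - 4*α^2*β*m1 - α^2*β*l2 - 2*α^2*β + 6*α^2*l1^2 + 2*α^2*l1*m1
    + 2*α^2*l1 + 2*α*β^3 + 4*α*β^2*l1 + 4*α*β^2*m1 + α*β^2*l2 + 2*α*β^2 - 8*α*β*l1^2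
    - 2*α*β*l1 + 4*α*β*m1 - 2*α*l1^2 - 2*α*l1*m1 - 2*β^4 - 4*β^2*m1 + 4*β*l1^2)
    / ((α - β)*(α - 2*β))

/-- The coefficient of `s₀₁` in `a₀ * s₁₂`. -/
def coefS (α β l1 m1 : F) : F :=
  (4*α^2 - 2*α*β - 4*α*l1 - 4*α*m1 - α + 4*β^2 - 2*β + 4*m1) / (α - 2*β)

variable [IsScalarTower F V V]

theorem AxisFrame.mul_s12 (h : AxisFrame α β a τ φ) (hchar : (2 : F) ≠ 0)
    (hαβ : α - β ≠ 0) (h2β : α - 2 * β ≠ 0) {b₁ b₂ s s02 s12 : V} {l1 m1 l2 : F}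
    (hb₁ : τ b₁ = b₁) (hφ₁ : φ b₁ = 2 * l1) (hφ₂ : φ b₂ = 2 * l2)
    (h01 : a * b₁ = (2 : F) • s + (2 * β) • a + β • b₁)
    (h02 : a * b₂ = (2 : F) • s02 + (2 * β) • a + β • b₂)
    (h11 : b₁ * b₁ = (1 + 2 * β) • b₁ + (2 : F) • s12)
    (h1s : b₁ * s = (m1 - β - β * m1 + (α - β) * (β - m1)) • b₁
      + ((α - β) * β / 2) • ((2 : F) • a + b₂) + (2 * (α - β)) • s) :
    a * s12 = coefA α β l1 m1 l2 • a + (β / 2 * coefS α β l1 m1) • b₁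
      + coefS α β l1 m1 • s + (2 * β * (α - β) / (α - 2 * β)) • s02
      + (β ^ 2 * (α - β) / (α - 2 * β)) • b₂ := by
  have hs := h.phi_s hchar hφ₁ h01
  have h0s := h.mul_s hchar hb₁ hφ₁ h01
  have hz := zeroPart_eq (α := α) hφ₁ h01
  have ha := alphaPart_eq hφ₁ h01
  have e1 := h.zero_mul b₁ b₁ hb₁ hb₁
  have e2 := h.phi_zero_mul b₁ b₁ hb₁ hb₁
  have e3 := h.alpha_mul b₁ b₁ hb₁ hb₁
  rw [← e1, hφ₁] at e3
  rw [hz] at e2 e3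
  rw [ha] at e3
  simp only [add_mul, sub_mul, mul_add, mul_sub, smul_mul_assoc, mul_smul_comm, h11, h01,
    mul_comm s b₁, h1s, map_add, map_sub, map_smul, hφ₁, hφ₂, hs, h.phi_self, smul_eq_mul]
    at e2 e3
  simp only [h.idem, h02, h0s] at e3
  have hμ : φ s12 = (-2*α*β*l1 + α*β*l2 - α*β + 2*α*l1^2 - 2*α*l1*m1 + α*l1 + 2*β^2*l1 - β^2*l2
      + β^2 - β*l1 - 2*l1^2 + 2*l1*m1) / (α - β) := by
    rw [eq_div_iff hαβ]
    refine mul_left_cancel₀ hchar ?_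
    field_simp at e2
    linear_combination e2
  rw [hμ] at e3
  linear_combination (norm := skip) (-1 / (2 * (α - 2 * β)) : F) • e3
  simp only [coefA, coefS]
  match_scalars <;> field_simp <;> ring

/-- The coefficient of `a₃ - a₋₁` in `a₄ - a₋₂`. -/
def shiftX (α β l1 m1 : F) : F :=
  (2*α^2*m1 + 10*α*β^2 - 4*α*β*l1 - 8*α*β*m1 + α*β - 2*α*m1 - 4*β^3 - 6*β^2 + 8*β*m1) / (β*(α -
    β)*(α - 4*β))

/-- The coefficient of `a₂ - a₀` in `a₄ - a₋₂`. -/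
def shiftY (α β l1 m1 l2 : F) : F :=
  (3*α^3*β - 4*α^3*l1 + 10*α^2*β^2 - 16*α^2*β*l1 - 4*α^2*β*m1 - 2*α^2*β*l2 + 12*α^2*l1^2 +
    4*α^2*l1*m1 - 17*α*β^3 + 24*α*β^2*l1 + 2*α*β^2*l2 - 8*α*β^2 - 16*α*β*l1^2 + 12*α*β*l1 +
    4*α*β*m1 - 4*α*l1^2 - 4*α*l1*m1 + 4*β^4 + 8*β^3 - 16*β^2*l1 + 8*β*l1^2) / (β*(α - β)^2*(α -
    4*β))

/-- The coefficient of `s₀₁` in `s₀₁ * s₀₁`. -/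
def sqS (α β l1 m1 : F) : F :=
  (-6*α^2*β + 2*α^2*l1 + α^2*m1 + 10*α*β^2 - 2*α*β*l1 + α*β - α*m1 - 4*β^3) / ((α - 2*β))

theorem AxisFrame.s_mul_s (h : AxisFrame α β a τ φ) (hchar : (2 : F) ≠ 0) (hβ : β ≠ 0)
    (hαβ : α - β ≠ 0) (h2β : α - 2 * β ≠ 0) (h4β : α - 4 * β ≠ 0) {b₁ b₂ s s02 s12 : V}
    {l1 m1 l2 : F} (hb₁ : τ b₁ = b₁) (hφ₁ : φ b₁ = 2 * l1) (hφ₂ : φ b₂ = 2 * l2)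
    (h01 : a * b₁ = (2 : F) • s + (2 * β) • a + β • b₁)
    (h02 : a * b₂ = (2 : F) • s02 + (2 * β) • a + β • b₂)
    (h11 : b₁ * b₁ = (1 + 2 * β) • b₁ + (2 : F) • s12)
    (h1s : b₁ * s = (m1 - β - β * m1 + (α - β) * (β - m1)) • b₁
      + ((α - β) * β / 2) • ((2 : F) • a + b₂) + (2 * (α - β)) • s) :
    s * s = (β * (α - β) ^ 2 * (α - 4 * β) / (2 ^ 2 * (α - 2 * β))) •
        ((1 - shiftY α β l1 m1 l2) • a - shiftX α β l1 m1 • b₁ + b₂)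
      + sqS α β l1 m1 • s - (α * β * (α - β) / (2 * (α - 2 * β))) • s02
      + (β * (α - β) / 2) • s12 := by
  have h0s := h.mul_s hchar hb₁ hφ₁ h01
  have hX := h.mul_s12 hchar hαβ h2β hb₁ hφ₁ hφ₂ h01 h02 h11 h1s
  have e1 := h.zero_mul b₁ b₁ hb₁ hb₁
  rw [zeroPart_eq hφ₁ h01, alphaPart_eq hφ₁ h01] at e1
  simp only [add_mul, sub_mul, mul_add, mul_sub, smul_mul_assoc, mul_smul_comm, h11, h01,
    mul_comm s b₁, mul_comm s a, mul_comm b₁ a, h1s, h.idem, h02, h0s, hX] at e1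
  linear_combination (norm := skip) (1 / 2 ^ 2 : F) • e1
  simp only [coefA, coefS, sqS, shiftX, shiftY]
  obtain ⟨c, hc⟩ : ∃ c, c = α - 2 * β := ⟨_, rfl⟩
  obtain ⟨d, hd⟩ : ∃ d, d = α - 4 * β := ⟨_, rfl⟩
  simp only [← hc, ← hd] at h2β h4β ⊢
  match_scalars <;> field_simp <;> (try simp only [hc, hd]) <;> ring

/-- The coefficient of `a₀` in `s₀₃`. -/
def threeA (α β l1 m1 l2 m2 : F) : F :=
  (2*α^5*β - 6*α^5*l1 + 16*α^4*β^2 - 4*α^4*β*l1 - 12*α^4*β*m1 + 2*α^4*β*l2 - 3*α^4*β +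
    8*α^4*l1^2 + 8*α^4*l1*m1 + 8*α^4*l1 - 34*α^3*β^3 + 14*α^3*β^2*l1 + 16*α^3*β^2*m1 -
    14*α^3*β^2*l2 - 2*α^3*β^2*m2 - 6*α^3*β^2 - 12*α^3*β*l1*m1 - 2*α^3*β*l1 + 12*α^3*β*m1^2 +
    8*α^3*β*m1 - 2*α^3*β*l2 + α^3*β - 16*α^3*l1^2 - 8*α^3*l1*m1 - 2*α^3*l1 - 8*α^2*β^4 +
    28*α^2*β^3*l1 + 20*α^2*β^3*m1 + 24*α^2*β^3*l2 + 6*α^2*β^3*m2 + 29*α^2*β^3 - 40*α^2*β^2*l1^2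
    - 34*α^2*β^2*l1 - 40*α^2*β^2*m1^2 - 8*α^2*β^2*m1 + 10*α^2*β^2*l2 - α^2*β^2 + 40*α^2*β*l1^2
    + 12*α^2*β*l1*m1 - 2*α^2*β*l1 - 4*α^2*β*m1^2 + 8*α^2*l1^2 + 32*α*β^5 - 32*α*β^4*l1 -
    24*α*β^4*m1 - 12*α*β^4*l2 - 4*α*β^4*m2 - 16*α*β^4 + 32*α*β^3*l1^2 + 12*α*β^3*l1 +
    32*α*β^3*m1^2 - 16*α*β^3*m1 - 16*α*β^3*l2 - 4*α*β^3 - 8*α*β^2*l1^2 + 20*α*β^2*l1 +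
    16*α*β^2*m1^2 - 24*α*β*l1^2 - 8*β^6 - 4*β^5 + 16*β^4*l1 + 16*β^4*m1 + 8*β^4*l2 + 4*β^4 -
    16*β^3*l1^2 - 16*β^3*l1 - 16*β^3*m1^2 + 16*β^2*l1^2) / (β*(α - β)^2*(α - 2*β)*(α - 4*β))

/-- The coefficient of `a₁ + a₋₁` in `s₀₃`. -/
def threeB (α β l1 m1 m2 : F) : F :=
  (-α^4*β + 8*α^4*m1 + 16*α^3*β^2 - 24*α^3*β*m1 + 2*α^3*β*m2 + 2*α^3*β - 4*α^3*l1*m1 -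
    12*α^3*m1^2 - 4*α^3*m1 - 13*α^2*β^3 - 16*α^2*β^2*l1 - 6*α^2*β^2*m2 - 14*α^2*β^2 +
    8*α^2*β*l1*m1 + 40*α^2*β*m1^2 + 12*α^2*β*m1 + 4*α^2*l1*m1 + 4*α^2*m1^2 + 6*α*β^4 +
    16*α*β^3*l1 + 16*α*β^3*m1 + 4*α*β^3*m2 + 12*α*β^3 - 32*α*β^2*m1^2 + 8*α*β^2*m1 -
    8*α*β*l1*m1 - 16*α*β*m1^2 - 8*β^5 - 16*β^3*m1 + 16*β^2*m1^2) / (2*β*(α - β)*(α - 2*β)*(α -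
    4*β))

/-- The coefficient of `a₂ + a₋₂` in `s₀₃`. -/
def threeC (α β l1 m1 : F) : F :=
  (-2*α^3*β - 2*α^3*l1 + 12*α^2*β*l1 + 4*α^2*β*m1 - α^2*β + 2*α^2*l1 + 16*α*β^3 - 16*α*β^2*l1 -
    8*α*β^2*m1 + 8*α*β^2 - 12*α*β*l1 - 8*β^4 - 12*β^3 + 16*β^2*l1) / (2*β*(α - 2*β)*(α - 4*β))

/-- The coefficient of `s₀₁` in `s₀₃`. -/
def threeS (α β l1 m1 m2 : F) : F :=
  (17*α^4*β - 8*α^4*m1 - 40*α^3*β^2 - 16*α^3*β*l1 + 8*α^3*β*m1 - 2*α^3*β*m2 - 6*α^3*β +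
    4*α^3*l1*m1 + 12*α^3*m1^2 + 4*α^3*m1 + 37*α^2*β^3 + 32*α^2*β^2*l1 + 16*α^2*β^2*m1 +
    6*α^2*β^2*m2 + 10*α^2*β^2 - 8*α^2*β*l1*m1 - 40*α^2*β*m1^2 + 4*α^2*β*m1 - 4*α^2*l1*m1 -
    4*α^2*m1^2 - 22*α*β^4 - 16*α*β^3*l1 - 16*α*β^3*m1 - 4*α*β^3*m2 - 4*α*β^3 + 32*α*β^2*m1^2 -
    24*α*β^2*m1 + 8*α*β*l1*m1 + 16*α*β*m1^2 + 8*β^5 + 16*β^3*m1 - 16*β^2*m1^2) / (β*(α -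
    β)^2*(α - 2*β)*(α - 4*β))

/-- The coefficient of `s₀₂` in `s₀₃`. -/
def threeD (α β l1 m1 : F) : F :=
  (2*α^3*β + 2*α^3*l1 + 8*α^2*β^2 - 12*α^2*β*l1 - 4*α^2*β*m1 + α^2*β - 2*α^2*l1 - 24*α*β^3 +
    16*α*β^2*l1 + 8*α*β^2*m1 - 8*α*β^2 + 12*α*β*l1 + 8*β^4 + 12*β^3 - 16*β^2*l1) / (β*(α -
    β)*(α - 2*β)*(α - 4*β))

theorem AxisFrame.s03_eq (h : AxisFrame α β a τ φ) (hchar : (2 : F) ≠ 0) (hβ : β ≠ 0)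
    (hαβ : α - β ≠ 0) (h2β : α - 2 * β ≠ 0) (h4β : α - 4 * β ≠ 0)
    {b₁ b₂ b₃ s s02 s12 s03 : V} {l1 m1 l2 m2 : F} (hb₁ : τ b₁ = b₁) (hb₂ : τ b₂ = b₂)
    (hφ₁ : φ b₁ = 2 * l1) (hφ₂ : φ b₂ = 2 * l2)
    (h01 : a * b₁ = (2 : F) • s + (2 * β) • a + β • b₁)
    (h02 : a * b₂ = (2 : F) • s02 + (2 * β) • a + β • b₂)
    (h03 : a * b₃ = (2 : F) • s03 + (2 * β) • a + β • b₃)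
    (h11 : b₁ * b₁ = (1 + 2 * β) • b₁ + (2 : F) • s12)
    (h1s : b₁ * s = (m1 - β - β * m1 + (α - β) * (β - m1)) • b₁
      + ((α - β) * β / 2) • ((2 : F) • a + b₂) + (2 * (α - β)) • s)
    (h2s : b₂ * s = (l1 - β - β * l1 + (α - β) * (β - l1)) • b₂
      + ((α - β) * β / 2) • (b₁ + b₃) + (2 * (α - β)) • s)
    (h1s02 : b₁ * s02 = coefA α β m1 l1 m2 • b₁
      + (β / 2 * coefS α β m1 l1) • ((2 : F) • a + b₂)
      + (β ^ 2 * (α - β) / (α - 2 * β)) • (b₁ + b₃) + (2 * coefS α β m1 l1) • s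
      + (2 * (2 * β * (α - β) / (α - 2 * β))) • s12) :
    s03 = threeA α β l1 m1 l2 m2 • a + threeB α β l1 m1 m2 • b₁ + threeC α β l1 m1 • b₂
      + ((α - β) / 2) • b₃ + threeS α β l1 m1 m2 • s + threeD α β l1 m1 • s02
      - (4 * α / (α - 4 * β)) • s12 := by
  have h0s := h.mul_s hchar hb₁ hφ₁ h01
  have h0s02 := h.mul_s hchar hb₂ hφ₂ h02
  have hX := h.mul_s12 hchar hαβ h2β hb₁ hφ₁ hφ₂ h01 h02 h11 h1s
  have e := h.mul_commutator hb₁ hb₂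
  rw [zeroPart_eq hφ₁ h01, zeroPart_eq hφ₂ h02] at e
  simp only [add_mul, sub_mul, mul_add, mul_sub, smul_mul_assoc, mul_smul_comm,
    mul_comm s b₂, mul_comm s02 b₁, mul_comm b₂ b₁, h1s02, h2s, h.idem, h01, h02, h03, h0s,
    h0s02, hX] at e
  linear_combination (norm := skip) (-(α - 2 * β) / (2 * β * (α - β) * (α - 4 * β)) : F) • e
  simp only [coefA, coefS, threeA, threeB, threeC, threeS, threeD]
  obtain ⟨c, hc⟩ : ∃ c, c = α - 2 * β := ⟨_, rfl⟩
  obtain ⟨d, hd⟩ : ∃ d, d = α - 4 * β := ⟨_, rfl⟩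
  simp only [← hc, ← hd] at h2β h4β ⊢
  match_scalars <;> field_simp <;> (try simp only [hc, hd]) <;> ring

end Products
end Axial

namespace Axial

section Frame

variable {F : Type*} [Field F] {V : Type*} [NonUnitalNonAssocCommRing V] [Module F V]

/-- The vector `x * y - β • (x + y)`. -/
def sv (β : F) (x y : V) : V := x * y - β • (x + y)

theorem sv_comm (β : F) (x y : V) : sv β x y = sv β y x := by
  rw [sv, sv, mul_comm, add_comm]

theorem mul_eq_sv (β : F) (x y : V) : x * y = sv β x y + β • (x + y) := by
  rw [sv, sub_add_cancel]

theorem AxisFrame.map_sv {α β : F} {a : V} {τ : V ≃ₗ[F] V} {φ : V →ₗ[F] F}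
    (h : AxisFrame α β a τ φ) (x y : V) : τ (sv β x y) = sv β (τ x) (τ y) := by
  rw [sv, sv, map_sub, h.tau_mul, map_smul, map_add]

theorem AxisFrame.sv_tau {α β : F} {a : V} {τ : V ≃ₗ[F] V} {φ : V →ₗ[F] F}
    (h : AxisFrame α β a τ φ) (x : V) : sv β a (τ x) = sv β a x := by
  have e := h.mul_sub_tau x
  rw [mul_sub] at e
  rw [sv, sv]
  linear_combination (norm := module) (-1 : F) • e

/-- Two nonzero axes `a 0`, `a 1` together with the sequence `a` that their Miyamoto involutions
`τ₀`, `τ₁` generate, and the projections `φ₀`, `φ₁` to the coefficients of `a 0`, `a 1`. -/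
structure Frame (α β l1 m1 l2 m2 : F) (a : ℤ → V) (τ₀ τ₁ : V ≃ₗ[F] V) (φ₀ φ₁ : V →ₗ[F] F) :
    Prop where
  axis₀ : AxisFrame α β (a 0) τ₀ φ₀
  axis₁ : AxisFrame α β (a 1) τ₁ φ₁
  tau₀ : ∀ i, τ₀ (a i) = a (-i)
  tau₁ : ∀ i, τ₁ (a i) = a (2 - i)
  phi₀_one : φ₀ (a 1) = l1
  phi₀_two : φ₀ (a 2) = l2
  phi₁_zero : φ₁ (a 0) = m1
  phi₁_neg_one : φ₁ (a (-1)) = m2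

namespace Frame

variable {α β l1 m1 l2 m2 : F} {a : ℤ → V} {τ₀ τ₁ : V ≃ₗ[F] V} {φ₀ φ₁ : V →ₗ[F] F}

theorem flip (h : Frame α β l1 m1 l2 m2 a τ₀ τ₁ φ₀ φ₁) :
    Frame α β m1 l1 m2 l2 (fun i => a (1 - i)) τ₁ τ₀ φ₁ φ₀ where
  axis₀ := h.axis₁
  axis₁ := h.axis₀
  tau₀ i := by rw [h.tau₁]; congr 1; ring
  tau₁ i := by rw [h.tau₀]; congr 1; ring
  phi₀_one := h.phi₁_zero
  phi₀_two := h.phi₁_neg_one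
  phi₁_zero := h.phi₀_one
  phi₁_neg_one := h.phi₀_two

theorem sv_zero_neg (h : Frame α β l1 m1 l2 m2 a τ₀ τ₁ φ₀ φ₁) (n : ℤ) :
    sv β (a 0) (a (-n)) = sv β (a 0) (a n) := by
  rw [← h.tau₀ n, h.axis₀.sv_tau]

theorem sv_one_sub (h : Frame α β l1 m1 l2 m2 a τ₀ τ₁ φ₀ φ₁) (n : ℤ) :
    sv β (a 1) (a (2 - n)) = sv β (a 1) (a n) := by
  rw [← h.tau₁ n, h.axis₁.sv_tau]

theorem sv_one_two (h : Frame α β l1 m1 l2 m2 a τ₀ τ₁ φ₀ φ₁) :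
    sv β (a 1) (a 2) = sv β (a 0) (a 1) := by
  have := h.sv_one_sub 0
  rw [sub_zero] at this
  rw [this, sv_comm]

theorem tau₀_add (h : Frame α β l1 m1 l2 m2 a τ₀ τ₁ φ₀ φ₁) (n : ℤ) :
    τ₀ (a n + a (-n)) = a n + a (-n) := by
  rw [map_add, h.tau₀, h.tau₀, neg_neg, add_comm]

theorem tau₀_sv_zero (h : Frame α β l1 m1 l2 m2 a τ₀ τ₁ φ₀ φ₁) (n : ℤ) :
    τ₀ (sv β (a 0) (a n)) = sv β (a 0) (a n) := by
  rw [h.axis₀.map_sv, h.tau₀, h.tau₀, neg_zero, h.sv_zero_neg]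

theorem tau₀_sv_one_neg_one (h : Frame α β l1 m1 l2 m2 a τ₀ τ₁ φ₀ φ₁) :
    τ₀ (sv β (a 1) (a (-1))) = sv β (a 1) (a (-1)) := by
  rw [h.axis₀.map_sv, h.tau₀, h.tau₀, neg_neg, sv_comm]

theorem tau₁_sv_zero_one (h : Frame α β l1 m1 l2 m2 a τ₀ τ₁ φ₀ φ₁) :
    τ₁ (sv β (a 0) (a 1)) = sv β (a 0) (a 1) := by
  rw [h.axis₁.map_sv, h.tau₁, h.tau₁, sub_zero, show (2 : ℤ) - 1 = 1 by norm_num, sv_comm,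
    h.sv_one_two]

theorem tau₁_sv_zero_two (h : Frame α β l1 m1 l2 m2 a τ₀ τ₁ φ₀ φ₁) :
    τ₁ (sv β (a 0) (a 2)) = sv β (a 0) (a 2) := by
  rw [h.axis₁.map_sv, h.tau₁, h.tau₁, sub_zero, sub_self, sv_comm]

theorem tau₁_sv_one_neg_one (h : Frame α β l1 m1 l2 m2 a τ₀ τ₁ φ₀ φ₁) :
    τ₁ (sv β (a 1) (a (-1))) = sv β (a 1) (a (-1)) := by
  rw [h.axis₁.map_sv, h.tau₁, h.tau₁, show (2 : ℤ) - 1 = 1 by norm_num, h.sv_one_sub]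

theorem zero_mul_add (h : Frame α β l1 m1 l2 m2 a τ₀ τ₁ φ₀ φ₁) (n : ℤ) : a 0 * (a n + a (-n))
    = (2 : F) • sv β (a 0) (a n) + (2 * β) • a 0 + β • (a n + a (-n)) := by
  rw [mul_add, mul_eq_sv β (a 0) (a n), mul_eq_sv β (a 0) (a (-n)), h.sv_zero_neg]
  module

theorem phi₀_add_one (h : Frame α β l1 m1 l2 m2 a τ₀ τ₁ φ₀ φ₁) :
    φ₀ (a 1 + a (-1)) = 2 * l1 := by
  rw [map_add, ← h.tau₀ 1, h.axis₀.phi_tau, h.phi₀_one, two_mul]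

theorem phi₀_add_two (h : Frame α β l1 m1 l2 m2 a τ₀ τ₁ φ₀ φ₁) :
    φ₀ (a 2 + a (-2)) = 2 * l2 := by
  rw [map_add, ← h.tau₀ 2, h.axis₀.phi_tau, h.phi₀_two, two_mul]

theorem add_mul_add_one (h : Frame α β l1 m1 l2 m2 a τ₀ τ₁ φ₀ φ₁) :
    (a 1 + a (-1)) * (a 1 + a (-1))
    = (1 + 2 * β) • (a 1 + a (-1)) + (2 : F) • sv β (a 1) (a (-1)) := by
  have e : a (-1) * a (-1) = a (-1) := by
    rw [← h.tau₀ 1, ← h.axis₀.tau_mul, h.axis₁.idem]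
  rw [add_mul, mul_add, mul_add, e, h.axis₁.idem, mul_comm (a (-1)) (a 1),
    mul_eq_sv β (a 1) (a (-1))]
  module

variable [SMulCommClass F V V]

theorem zero_mul_s (h : Frame α β l1 m1 l2 m2 a τ₀ τ₁ φ₀ φ₁) (hchar : (2 : F) ≠ 0) :
    a 0 * sv β (a 0) (a 1)
    = (l1 - β - β * l1 + (α - β) * (β - l1)) • a 0 + ((α - β) * β / 2) • (a 1 + a (-1))
      + (α - β) • sv β (a 0) (a 1) :=
  h.axis₀.mul_s hchar (h.tau₀_add 1) h.phi₀_add_one (h.zero_mul_add 1)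

theorem zero_mul_s02 (h : Frame α β l1 m1 l2 m2 a τ₀ τ₁ φ₀ φ₁) (hchar : (2 : F) ≠ 0) :
    a 0 * sv β (a 0) (a 2)
    = (l2 - β - β * l2 + (α - β) * (β - l2)) • a 0 + ((α - β) * β / 2) • (a 2 + a (-2))
      + (α - β) • sv β (a 0) (a 2) :=
  h.axis₀.mul_s hchar (h.tau₀_add 2) h.phi₀_add_two (h.zero_mul_add 2)

theorem one_mul_s (h : Frame α β l1 m1 l2 m2 a τ₀ τ₁ φ₀ φ₁) (hchar : (2 : F) ≠ 0) :
    a 1 * sv β (a 0) (a 1)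
    = (m1 - β - β * m1 + (α - β) * (β - m1)) • a 1 + ((α - β) * β / 2) • (a 0 + a 2)
      + (α - β) • sv β (a 0) (a 1) := by
  have e := h.flip.zero_mul_s hchar
  simpa only [show (1 : ℤ) - 0 = 1 by norm_num, show (1 : ℤ) - 1 = 0 by norm_num,
    show (1 : ℤ) - -1 = 2 by norm_num, sv_comm β (a 1) (a 0)] using e

theorem add_one_mul_s (h : Frame α β l1 m1 l2 m2 a τ₀ τ₁ φ₀ φ₁) (hchar : (2 : F) ≠ 0) :
    (a 1 + a (-1)) * sv β (a 0) (a 1)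
    = (m1 - β - β * m1 + (α - β) * (β - m1)) • (a 1 + a (-1))
      + ((α - β) * β / 2) • ((2 : F) • a 0 + (a 2 + a (-2)))
      + (2 * (α - β)) • sv β (a 0) (a 1) := by
  have e := h.one_mul_s hchar
  have e' := congrArg τ₀ e
  simp only [h.axis₀.tau_mul, map_add, map_smul, h.tau₀_sv_zero, h.tau₀, neg_zero] at e'
  rw [add_mul]
  linear_combination (norm := module) (1 : F) • e + (1 : F) • e'

theorem add_two_mul_s (h : Frame α β l1 m1 l2 m2 a τ₀ τ₁ φ₀ φ₁) (hchar : (2 : F) ≠ 0) :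
    (a 2 + a (-2)) * sv β (a 0) (a 1)
    = (l1 - β - β * l1 + (α - β) * (β - l1)) • (a 2 + a (-2))
      + ((α - β) * β / 2) • ((a 1 + a (-1)) + (a 3 + a (-3)))
      + (2 * (α - β)) • sv β (a 0) (a 1) := by
  have e := congrArg τ₁ (h.zero_mul_s hchar)
  simp only [h.axis₁.tau_mul, map_add, map_smul, h.tau₁_sv_zero_one, h.tau₁] at e
  norm_num at e
  have e' := congrArg τ₀ e
  simp only [h.axis₀.tau_mul, map_add, map_smul, h.tau₀_sv_zero, h.tau₀] at e'
  rw [add_mul]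
  linear_combination (norm := module) (1 : F) • e + (1 : F) • e'

variable [IsScalarTower F V V]

theorem zero_mul_s12 (h : Frame α β l1 m1 l2 m2 a τ₀ τ₁ φ₀ φ₁) (hchar : (2 : F) ≠ 0)
    (hαβ : α - β ≠ 0) (h2β : α - 2 * β ≠ 0) :
    a 0 * sv β (a 1) (a (-1))
    = coefA α β l1 m1 l2 • a 0 + (β / 2 * coefS α β l1 m1) • (a 1 + a (-1))
      + coefS α β l1 m1 • sv β (a 0) (a 1)
      + (2 * β * (α - β) / (α - 2 * β)) • sv β (a 0) (a 2)
      + (β ^ 2 * (α - β) / (α - 2 * β)) • (a 2 + a (-2)) :=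
  h.axis₀.mul_s12 hchar hαβ h2β (h.tau₀_add 1) h.phi₀_add_one h.phi₀_add_two (h.zero_mul_add 1)
    (h.zero_mul_add 2) h.add_mul_add_one (h.add_one_mul_s hchar)

theorem add_one_mul_s02 (h : Frame α β l1 m1 l2 m2 a τ₀ τ₁ φ₀ φ₁) (hchar : (2 : F) ≠ 0)
    (hαβ : α - β ≠ 0) (h2β : α - 2 * β ≠ 0) :
    (a 1 + a (-1)) * sv β (a 0) (a 2)
    = coefA α β m1 l1 m2 • (a 1 + a (-1))
      + (β / 2 * coefS α β m1 l1) • ((2 : F) • a 0 + (a 2 + a (-2)))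
      + (β ^ 2 * (α - β) / (α - 2 * β)) • ((a 1 + a (-1)) + (a 3 + a (-3)))
      + (2 * coefS α β m1 l1) • sv β (a 0) (a 1)
      + (2 * (2 * β * (α - β) / (α - 2 * β))) • sv β (a 1) (a (-1)) := by
  have e := h.flip.zero_mul_s12 hchar hαβ h2β
  simp only [show (1 : ℤ) - 0 = 1 by norm_num, show (1 : ℤ) - 1 = 0 by norm_num,
    show (1 : ℤ) - 2 = -1 by norm_num, show (1 : ℤ) - -1 = 2 by norm_num,
    show (1 : ℤ) - -2 = 3 by norm_num, sv_comm β (a 1) (a 0)] at e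
  have e' := congrArg τ₀ e
  simp only [h.axis₀.tau_mul, map_add, map_smul, h.tau₀_sv_zero, h.tau₀_sv_one_neg_one, h.tau₀,
    neg_neg, neg_zero] at e'
  rw [add_mul]
  linear_combination (norm := module) (1 : F) • e + (1 : F) • e'

theorem s03_eq (h : Frame α β l1 m1 l2 m2 a τ₀ τ₁ φ₀ φ₁) (hchar : (2 : F) ≠ 0)
    (hαβ : α - β ≠ 0) (h2β : α - 2 * β ≠ 0) (hβ : β ≠ 0) (h4β : α - 4 * β ≠ 0) :
    sv β (a 0) (a 3)
    = threeA α β l1 m1 l2 m2 • a 0 + threeB α β l1 m1 m2 • (a 1 + a (-1))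
      + threeC α β l1 m1 • (a 2 + a (-2)) + ((α - β) / 2) • (a 3 + a (-3))
      + threeS α β l1 m1 m2 • sv β (a 0) (a 1) + threeD α β l1 m1 • sv β (a 0) (a 2)
      - (4 * α / (α - 4 * β)) • sv β (a 1) (a (-1)) :=
  h.axis₀.s03_eq hchar hβ hαβ h2β h4β (h.tau₀_add 1) (h.tau₀_add 2) h.phi₀_add_one h.phi₀_add_two
    (h.zero_mul_add 1) (h.zero_mul_add 2) (h.zero_mul_add 3) h.add_mul_add_one
    (h.add_one_mul_s hchar) (h.add_two_mul_s hchar) (h.add_one_mul_s02 hchar hαβ h2β)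

/-- The square of `s₀₁` is fixed by `τ₁`, which gives a recurrence for the sequence `a`. -/
theorem shift_two (h : Frame α β l1 m1 l2 m2 a τ₀ τ₁ φ₀ φ₁) (hchar : (2 : F) ≠ 0)
    (hαβ : α - β ≠ 0) (h2β : α - 2 * β ≠ 0) (hβ : β ≠ 0) (h4β : α - 4 * β ≠ 0) :
    a 4 - a (-2)
    = shiftX α β l1 m1 • (a 3 - a (-1)) + shiftY α β l1 m1 l2 • (a 2 - a 0) := by
  have e := h.axis₀.s_mul_s hchar hβ hαβ h2β h4β (h.tau₀_add 1) h.phi₀_add_one h.phi₀_add_two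
    (h.zero_mul_add 1) (h.zero_mul_add 2) h.add_mul_add_one (h.add_one_mul_s hchar)
  have e' := congrArg τ₁ e
  simp only [h.axis₁.tau_mul, map_add, map_sub, map_smul, h.tau₁_sv_zero_one, h.tau₁_sv_zero_two,
    h.tau₁_sv_one_neg_one, h.tau₁, sub_zero, sub_self, show (2 : ℤ) - 1 = 1 by norm_num,
    show (2 : ℤ) - -1 = 3 by norm_num, show (2 : ℤ) - -2 = 4 by norm_num] at e'
  have hk : β * (α - β) ^ 2 * (α - 4 * β) / (2 ^ 2 * (α - 2 * β)) ≠ 0 :=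
    div_ne_zero (mul_ne_zero (mul_ne_zero hβ (pow_ne_zero _ hαβ)) h4β)
      (mul_ne_zero (pow_ne_zero _ hchar) h2β)
  generalize β * (α - β) ^ 2 * (α - 4 * β) / (2 ^ 2 * (α - 2 * β)) = k at hk e e'
  refine smul_right_injective V hk ?_
  dsimp only
  linear_combination (norm := module) (1 : F) • e - (1 : F) • e'

end Frame

end Frame

end Axial

namespace Axial

section Products

variable {F : Type*} [Field F] {V : Type*} [NonUnitalNonAssocCommRing V] [Module F V]
  [SMulCommClass F V V] [IsScalarTower F V V]

/-- Four times the product `s₀₁ * s₀₂`, up to the coefficients of `s₀₁`, `s₀₂` and `s₁₂`. -/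
theorem AxisFrame.exists_four_smul_s_mul_s02 {α β : F} {a : V} {τ : V ≃ₗ[F] V} {φ : V →ₗ[F] F}
    (h : AxisFrame α β a τ φ) {b₁ b₂ b₃ s s02 s12 s03 : V}
    {l1 l2 k c₀ c₂ u v x0 x1 x2 xs x02 y0 y1 y2 ys y12 z0 z1 z2 z3 zs z02 z12 t0 t1 t2 t3 ts t02 t12
      Y0 Y1 Y2 Y3 : F}
    (hb₁ : τ b₁ = b₁) (hb₂ : τ b₂ = b₂) (hφ₁ : φ b₁ = 2 * l1) (hφ₂ : φ b₂ = 2 * l2)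
    (hu : u = 2 * (1 - α) * l1 - 2 * β) (hv : v = 2 * β - 2 * l2)
    (h01 : a * b₁ = (2 : F) • s + (2 * β) • a + β • b₁)
    (h02 : a * b₂ = (2 : F) • s02 + (2 * β) • a + β • b₂)
    (h03 : a * b₃ = (2 : F) • s03 + (2 * β) • a + β • b₃)
    (h0s : a * s = c₀ • a + k • b₁ + (α - β) • s)
    (h0s02 : a * s02 = c₂ • a + k • b₂ + (α - β) • s02)
    (h0s12 : a * s12 = x0 • a + x1 • b₁ + xs • s + x02 • s02 + x2 • b₂)
    (h2s : b₂ * s = c₀ • b₂ + k • (b₁ + b₃) + (2 * (α - β)) • s)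
    (h1s02 : b₁ * s02 = y0 • b₁ + y1 • ((2 : F) • a + b₂) + y2 • (b₁ + b₃) + (2 * ys) • s
      + (2 * y12) • s12)
    (hs03 : s03 = z0 • a + z1 • b₁ + z2 • b₂ + z3 • b₃ + zs • s + z02 • s02 - z12 • s12)
    (h12 : b₁ * b₂ = t0 • a + t1 • b₁ + t2 • b₂ + t3 • b₃ + ts • s + t02 • s02 + t12 • s12)
    (hY0 : 4 * Y0 = (α - β) * (4 * y1 + 2 * β * v + β * t0) - 2 * v * c₀ + 2 * u * c₂ + u * v
      + 2 * β ^ 2 * u - ((α - β) * t0 + 2 * β * u)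
      - 2 * β * ((α - β) * (t1 + t2 + t3) - 4 * k - 2 * c₀ + β * u)
      - 2 * ((α - β) * t3 - 2 * k) * z0 - (α - β) * (ts - 4) * c₀
      - ((α - β) * t02 + 2 * u) * c₂ - (α - β) * t12 * x0)
    (hY1 : 4 * Y1 = (α - β) * (2 * y0 + 2 * y2 + β * v + β * t1) - 2 * v * k - 2 * β * k
      - β * ((α - β) * t1 - 2 * k) - 2 * ((α - β) * t3 - 2 * k) * z1 - (α - β) * (ts - 4) * k
      - (α - β) * t12 * x1)
    (hY2 : 4 * Y2 = (α - β) * (2 * y1 + β * t2) - 2 * β * c₀ + 2 * u * k + β ^ 2 * u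
      - β * ((α - β) * t2 - 2 * c₀ + β * u) - 2 * ((α - β) * t3 - 2 * k) * z2
      - ((α - β) * t02 + 2 * u) * k - (α - β) * t12 * x2)
    (hY3 : 4 * Y3 = (α - β) * (2 * y2 + β * t3) - 2 * β * k
      - ((α - β) * t3 - 2 * k) * (2 * z3 + β)) :
    ∃ q₁ q₂ q₃ : F, (4 : F) • (s * s02) = (4 * Y0) • a + (4 * Y1) • b₁ + (4 * Y2) • b₂
      + (4 * Y3) • b₃ + q₁ • s + q₂ • s02 + q₃ • s12 := by
  refine ⟨(α - β) * (4 * ys + β * ts - 4 * β) - 2 * ((α - β) * t1 - 2 * k)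
      - 2 * ((α - β) * t3 - 2 * k) * zs - (α - β) * (ts - 4) * (α - β) - (α - β) * t12 * xs,
    (α - β) * (β * t02 + 2 * u) + 2 * β * u - 2 * ((α - β) * t2 - 2 * c₀ + β * u)
      - 2 * ((α - β) * t3 - 2 * k) * z02 - ((α - β) * t02 + 2 * u) * (α - β)
      - (α - β) * t12 * x02,
    (α - β) * (4 * y12 + β * t12) + 2 * ((α - β) * t3 - 2 * k) * z12, ?_⟩
  have e := h.zero_mul b₁ b₂ hb₁ hb₂
  rw [zeroPart_eq hφ₁ h01, alphaPart_eq hφ₂ h02, ← hu, ← hv] at e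
  have hP : ((α - β) • b₁ - (2 : F) • s + u • a) * b₂
      = ((α - β) * t0 + 2 * β * u) • a + ((α - β) * t1 - 2 * k) • b₁
        + ((α - β) * t2 - 2 * c₀ + β * u) • b₂ + ((α - β) * t3 - 2 * k) • b₃
        + ((α - β) * (ts - 4)) • s + ((α - β) * t02 + 2 * u) • s02 + ((α - β) * t12) • s12 := by
    simp only [add_mul, sub_mul, smul_mul_assoc, mul_comm s b₂, h12, h2s, h02]
    module
  rw [hP] at e
  rw [hY0, hY1, hY2, hY3]
  simp only [add_mul, sub_mul, mul_add, mul_sub, smul_mul_assoc, mul_smul_comm, mul_comm s a,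
    mul_comm b₁ a, mul_comm s b₂, h.idem, h01, h02, h03, h0s, h0s02, h0s12, h12, h2s, h1s02,
    hs03] at e
  linear_combination (norm := module) (1 : F) • e

/-- The coefficient of `a₁ + a₋₁` in `s₀₁ * s₀₂`. -/
def prodB (α β l1 m1 l2 m2 : F) : F :=
  (-α^5*β + 8*α^5*m1 - 2*α^4*β^2 + 8*α^4*β*l1 - 24*α^4*β*m1 + 2*α^4*β*m2 + 2*α^4*β -
    4*α^4*l1*m1 - 12*α^4*m1^2 - 4*α^4*m1 - 33*α^3*β^3 - 8*α^3*β^2*l1 + 60*α^3*β^2*m1 +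
    2*α^3*β^2*l2 - 4*α^3*β^2*m2 - 10*α^3*β^2 - 12*α^3*β*l1^2 + 8*α^3*β*l1*m1 - 4*α^3*β*l1 +
    36*α^3*β*m1^2 + 18*α^3*β*m1 + 4*α^3*l1*m1 + 4*α^3*m1^2 + 32*α^2*β^4 + 48*α^2*β^3*l1 -
    6*α^2*β^3*l2 + 6*α^2*β^3*m2 + 40*α^2*β^3 + 24*α^2*β^2*l1^2 - 48*α^2*β^2*l1*m1 +
    4*α^2*β^2*l1 - 72*α^2*β^2*m1^2 - 40*α^2*β^2*m1 + α^2*β^2 + 4*α^2*β*l1^2 - 8*α^2*β*l1*m1 -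
    28*α^2*β*m1^2 - 2*α^2*β*m1 - 48*α*β^5 + 16*α*β^4*m1 + 4*α*β^4*l2 - 4*α*β^4*m2 -
    32*α*β^3*l1^2 - 48*α*β^3*l1 + 32*α*β^3*m1^2 - 40*α*β^3*m1 - 4*α*β^3 - 16*α*β^2*l1^2 +
    48*α*β^2*l1*m1 + 80*α*β^2*m1^2 + 8*α*β*m1^2 + 16*β^6 + 16*β^5 + 16*β^4*l1 - 32*β^4*m1 -
    12*β^4 + 16*β^3*l1^2 - 16*β^3*m1^2 + 40*β^3*m1 - 32*β^2*m1^2) / (2^2*β*(α - 2*β)*(α - 4*β))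

/-- The coefficient of `a₂ + a₋₂` in `s₀₁ * s₀₂`. -/
def prodC (α β l1 m1 : F) : F :=
  (-2*α^5*β - 2*α^5*l1 + 6*α^4*β^2 + 10*α^4*β*l1 + 4*α^4*β*m1 - α^4*β + 2*α^4*l1 - 26*α^3*β^3 -
    8*α^3*β^2*l1 - 12*α^3*β^2*m1 + 6*α^3*β^2 - 10*α^3*β*l1 + 34*α^2*β^4 + 8*α^2*β^3*l1 +
    32*α^2*β^3*m1 - 3*α^2*β^3 + 8*α^2*β^2*l1 + 4*α^2*β^2*m1 - 28*α*β^5 - 8*α*β^4*l1 -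
    24*α*β^4*m1 + 6*α*β^4 - 20*α*β^3*m1 + 16*β^6 - 8*β^5 + 16*β^4*m1) / (2^2*β*(α - 2*β)*(α -
    4*β))

end Products

end Axial

namespace Axial

section Coefficients

variable {F : Type*} [Field F]

theorem prodB_eq {α β : F} (hchar : (2 : F) ≠ 0) (hβ : β ≠ 0) (hαβ : α - β ≠ 0)
    (h2β : α - 2 * β ≠ 0) (h4β : α - 4 * β ≠ 0) {l1 m1 l2 m2 v k t1 t3 ts t12 : F}
    (hv : v = 2 * β - 2 * l2) (hk : k = (α - β) * β / 2)
    (ht1 : t1 = 2 * β + threeA α β m1 l1 m2 l2 + threeC α β m1 l1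
      - (α - β) / 2 * shiftX α β l1 m1)
    (ht3 : t3 = threeC α β m1 l1 + (α - β) / 2 * shiftX α β l1 m1)
    (hts : ts = 2 + 2 * threeS α β m1 l1 l2) (ht12 : t12 = 2 * threeD α β m1 l1) :
    4 * prodB α β l1 m1 l2 m2 = (α - β) * (2 * coefA α β m1 l1 m2
        + 2 * (β ^ 2 * (α - β) / (α - 2 * β)) + β * v + β * t1) - 2 * v * k - 2 * β * k
      - β * ((α - β) * t1 - 2 * k) - 2 * ((α - β) * t3 - 2 * k) * threeB α β l1 m1 m2
      - (α - β) * (ts - 4) * k - (α - β) * t12 * (β / 2 * coefS α β l1 m1) := by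
  subst hv hk ht1 ht3 hts ht12
  simp only [prodB, coefA, coefS, threeA, threeB, threeC, threeS, threeD, shiftX]
  obtain ⟨c, hc⟩ : ∃ c, c = α - 2 * β := ⟨_, rfl⟩
  obtain ⟨d, hd⟩ : ∃ d, d = α - 4 * β := ⟨_, rfl⟩
  simp only [← hc, ← hd] at h2β h4β ⊢
  field_simp
  subst hc hd
  ring

theorem prodC_eq {α β : F} (hchar : (2 : F) ≠ 0) (hβ : β ≠ 0) (hαβ : α - β ≠ 0)
    (h2β : α - 2 * β ≠ 0) (h4β : α - 4 * β ≠ 0) {l1 m1 l2 c₀ u k t2 t3 t02 t12 : F}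
    (hc₀ : c₀ = l1 - β - β * l1 + (α - β) * (β - l1))
    (hu : u = 2 * (1 - α) * l1 - 2 * β) (hk : k = (α - β) * β / 2)
    (ht2 : t2 = 2 * β + threeB α β m1 l1 l2 + (α - β) / 2 * (2 + shiftY α β l1 m1 l2))
    (ht3 : t3 = threeC α β m1 l1 + (α - β) / 2 * shiftX α β l1 m1)
    (ht02 : t02 = -2 * (4 * α / (α - 4 * β))) (ht12 : t12 = 2 * threeD α β m1 l1) :
    4 * prodC α β l1 m1 = (α - β) * (2 * (β / 2 * coefS α β m1 l1) + β * t2) - 2 * β * c₀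
      + 2 * u * k + β ^ 2 * u
      - β * ((α - β) * t2 - 2 * c₀ + β * u) - 2 * ((α - β) * t3 - 2 * k) * threeC α β l1 m1
      - ((α - β) * t02 + 2 * u) * k
      - (α - β) * t12 * (β ^ 2 * (α - β) / (α - 2 * β)) := by
  subst hc₀ hu hk ht2 ht3 ht02 ht12
  simp only [prodC, coefS, threeB, threeC, threeD, shiftX, shiftY]
  obtain ⟨c, hc⟩ : ∃ c, c = α - 2 * β := ⟨_, rfl⟩
  obtain ⟨d, hd⟩ : ∃ d, d = α - 4 * β := ⟨_, rfl⟩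
  simp only [← hc, ← hd] at h2β h4β ⊢
  field_simp
  subst hc hd
  ring

theorem prodD_eq {α β : F} (hchar : (2 : F) ≠ 0) (hβ : β ≠ 0) (hαβ : α - β ≠ 0)
    (h2β : α - 2 * β ≠ 0) (h4β : α - 4 * β ≠ 0) {l1 m1 k t3 : F} (hk : k = (α - β) * β / 2)
    (ht3 : t3 = threeC α β m1 l1 + (α - β) / 2 * shiftX α β l1 m1) :
    4 * (α ^ 2 * (α - β) ^ 2 / (2 ^ 2 * (α - 2 * β)))
      = (α - β) * (2 * (β ^ 2 * (α - β) / (α - 2 * β)) + β * t3) - 2 * β * k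
        - ((α - β) * t3 - 2 * k) * (2 * ((α - β) / 2) + β) := by
  subst hk ht3
  simp only [threeC, shiftX]
  obtain ⟨c, hc⟩ : ∃ c, c = α - 2 * β := ⟨_, rfl⟩
  obtain ⟨d, hd⟩ : ∃ d, d = α - 4 * β := ⟨_, rfl⟩
  simp only [← hc, ← hd] at h2β h4β ⊢
  field_simp
  subst hc hd
  ring

theorem polyA_eq {α β : F} (hchar : (2 : F) ≠ 0) (hβ : β ≠ 0) (hαβ : α - β ≠ 0)
    (h2β : α - 2 * β ≠ 0) (h4β : α - 4 * β ≠ 0) (l1 m1 l2 m2 : F) :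
    polyA α β m1 l1 m2 l2 = 2 * (α - 4 * β) ^ 2 * (prodB α β l1 m1 l2 m2
      + prodC α β l1 m1 * shiftX α β l1 m1 - α ^ 2 * (α - β) ^ 2 / (2 ^ 2 * (α - 2 * β))
        * (2 - shiftX α β m1 l1 * shiftX α β l1 m1 - shiftY α β m1 l1 m2)) := by
  simp only [polyA, prodB, prodC, shiftX, shiftY]
  obtain ⟨c, hc⟩ : ∃ c, c = α - 2 * β := ⟨_, rfl⟩
  obtain ⟨d, hd⟩ : ∃ d, d = α - 4 * β := ⟨_, rfl⟩
  simp only [← hc, ← hd] at h2β h4β ⊢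
  field_simp
  subst hc hd
  ring

set_option maxRecDepth 100000 in
set_option maxHeartbeats 4000000 in
theorem polyB_eq {α β : F} (hchar : (2 : F) ≠ 0) (hβ : β ≠ 0) (hαβ : α - β ≠ 0)
    (h2β : α - 2 * β ≠ 0) (h4β : α - 4 * β ≠ 0)
    {l1 m1 l2 m2 Y0 c₀ c₂ u v k t0 t1 t2 t3 ts t02 t12 : F}
    (hc₀ : c₀ = l1 - β - β * l1 + (α - β) * (β - l1))
    (hc₂ : c₂ = l2 - β - β * l2 + (α - β) * (β - l2))
    (hu : u = 2 * (1 - α) * l1 - 2 * β) (hv : v = 2 * β - 2 * l2) (hk : k = (α - β) * β / 2)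
    (ht0 : t0 = 2 * threeB α β m1 l1 l2 - (α - β) * shiftY α β l1 m1 l2)
    (ht1 : t1 = 2 * β + threeA α β m1 l1 m2 l2 + threeC α β m1 l1
      - (α - β) / 2 * shiftX α β l1 m1)
    (ht2 : t2 = 2 * β + threeB α β m1 l1 l2 + (α - β) / 2 * (2 + shiftY α β l1 m1 l2))
    (ht3 : t3 = threeC α β m1 l1 + (α - β) / 2 * shiftX α β l1 m1)
    (hts : ts = 2 + 2 * threeS α β m1 l1 l2)
    (ht02 : t02 = -2 * (4 * α / (α - 4 * β))) (ht12 : t12 = 2 * threeD α β m1 l1)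
    (hY0 : 4 * Y0 = (α - β) * (4 * (β / 2 * coefS α β m1 l1) + 2 * β * v + β * t0) - 2 * v * c₀
      + 2 * u * c₂ + u * v + 2 * β ^ 2 * u - ((α - β) * t0 + 2 * β * u)
      - 2 * β * ((α - β) * (t1 + t2 + t3) - 4 * k - 2 * c₀ + β * u)
      - 2 * ((α - β) * t3 - 2 * k) * threeA α β l1 m1 l2 m2 - (α - β) * (ts - 4) * c₀
      - ((α - β) * t02 + 2 * u) * c₂ - (α - β) * t12 * coefA α β l1 m1 l2) :
    2 / (β * (α - β)) * polyB α β m1 l1 m2 l2 = -(2 * (α - 4 * β) ^ 2) *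
      (Y0 - prodC α β l1 m1 * (1 - shiftY α β l1 m1 l2)
        + α ^ 2 * (α - β) ^ 2 / (2 ^ 2 * (α - 2 * β)) * shiftX α β m1 l1
          * (shiftY α β l1 m1 l2 + 1)) := by
  have h4 : (4 : F) ≠ 0 := by
    rw [show (4 : F) = 2 * 2 by norm_num]; exact mul_ne_zero hchar hchar
  subst hc₀ hc₂ hu hv hk ht0 ht1 ht2 ht3 hts ht02 ht12
  refine mul_left_cancel₀ h4 ?_
  have e (p q r : F) : 4 * (p * (Y0 - q + r)) = p * (4 * Y0 - 4 * q + 4 * r) := by ring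
  rw [e, hY0]
  clear hY0 h4 e
  simp only [polyB, prodC, coefA, coefS, threeA, threeB, threeC, threeS, threeD, shiftX, shiftY]
  obtain ⟨c, hc⟩ : ∃ c, c = α - 2 * β := ⟨_, rfl⟩
  obtain ⟨d, hd⟩ : ∃ d, d = α - 4 * β := ⟨_, rfl⟩
  simp only [← hc, ← hd] at h2β h4β ⊢
  field_simp
  subst hc hd
  ring

end Coefficients
end Axial

namespace Axial

namespace Frame

variable {F : Type*} [Field F] {V : Type*} [NonUnitalNonAssocCommRing V] [Module F V]
  [SMulCommClass F V V] [IsScalarTower F V V] {α β l1 m1 l2 m2 : F} {a : ℤ → V}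
  {τ₀ τ₁ : V ≃ₗ[F] V} {φ₀ φ₁ : V →ₗ[F] F}

theorem add_one_mul_add_two (h : Frame α β l1 m1 l2 m2 a τ₀ τ₁ φ₀ φ₁) (hchar : (2 : F) ≠ 0)
    (hαβ : α - β ≠ 0) (h2β : α - 2 * β ≠ 0) (hβ : β ≠ 0) (h4β : α - 4 * β ≠ 0) :
    (a 1 + a (-1)) * (a 2 + a (-2))
      = (2 * threeB α β m1 l1 l2 - (α - β) * shiftY α β l1 m1 l2) • a 0
        + (2 * β + threeA α β m1 l1 m2 l2 + threeC α β m1 l1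
          - (α - β) / 2 * shiftX α β l1 m1) • (a 1 + a (-1))
        + (2 * β + threeB α β m1 l1 l2
          + (α - β) / 2 * (2 + shiftY α β l1 m1 l2)) • (a 2 + a (-2))
        + (threeC α β m1 l1 + (α - β) / 2 * shiftX α β l1 m1) • (a 3 + a (-3))
        + (2 + 2 * threeS α β m1 l1 l2) • sv β (a 0) (a 1)
        + (-2 * (4 * α / (α - 4 * β))) • sv β (a 0) (a 2)
        + (2 * threeD α β m1 l1) • sv β (a 1) (a (-1)) := by
  have e₄ := h.shift_two hchar hαβ h2β hβ h4β
  have e₅ := congrArg τ₀ e₄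
  have e := h.flip.s03_eq hchar hαβ h2β hβ h4β
  simp only [show (1 : ℤ) - 0 = 1 by norm_num, show (1 : ℤ) - 1 = 0 by norm_num,
    show (1 : ℤ) - 2 = -1 by norm_num, show (1 : ℤ) - 3 = -2 by norm_num,
    show (1 : ℤ) - -1 = 2 by norm_num, show (1 : ℤ) - -2 = 3 by norm_num,
    show (1 : ℤ) - -3 = 4 by norm_num, sv_comm β (a 1) (a 0)] at e
  have e' := congrArg τ₀ e
  have e₁ := h.axis₀.map_sv (a 1) (a 2)
  simp only [h.sv_one_two, h.tau₀_sv_zero, h.tau₀] at e₁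
  simp only [map_add, map_sub, map_smul, h.axis₀.map_sv (a 1) (a (-2)), h.tau₀_sv_zero,
    h.tau₀_sv_one_neg_one, h.tau₀, neg_neg, neg_zero] at e' e₅
  rw [add_mul, mul_add, mul_add, mul_eq_sv β (a 1) (a 2), mul_eq_sv β (a 1) (a (-2)),
    mul_eq_sv β (a (-1)) (a 2), mul_eq_sv β (a (-1)) (a (-2)), h.sv_one_two, ← e₁]
  obtain ⟨k, hk⟩ : ∃ k, k = (α - β) / 2 := ⟨_, rfl⟩
  rw [← hk] at e e' ⊢
  rw [show α - β = 2 * k by rw [hk]; field_simp]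
  linear_combination (norm := module) (1 : F) • e + (1 : F) • e' + k • e₄ + k • e₅

theorem polyA_smul (h : Frame α β l1 m1 l2 m2 a τ₀ τ₁ φ₀ φ₁) (hchar : (2 : F) ≠ 0)
    (hαβ : α - β ≠ 0) (h2β : α - 2 * β ≠ 0) (hβ : β ≠ 0) (h4β : α - 4 * β ≠ 0) :
    polyA α β m1 l1 m2 l2 • (a 3 - a (-1))
      = (2 / (β * (α - β)) * polyB α β m1 l1 m2 l2) • (a 2 - a 0) := by
  have h4 : (4 : F) ≠ 0 := by
    rw [show (4 : F) = 2 * 2 by norm_num]; exact mul_ne_zero hchar hchar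
  obtain ⟨Y0, hY0⟩ := exists_eq_mul_right_of_dvd (isUnit_iff_ne_zero.2 h4).dvd
    (a := (4 : F)) (b :=
      (α - β) * (4 * (β / 2 * coefS α β m1 l1) + 2 * β * (2 * β - 2 * l2)
          + β * (2 * threeB α β m1 l1 l2 - (α - β) * shiftY α β l1 m1 l2))
      - 2 * (2 * β - 2 * l2) * (l1 - β - β * l1 + (α - β) * (β - l1))
      + 2 * (2 * (1 - α) * l1 - 2 * β) * (l2 - β - β * l2 + (α - β) * (β - l2))
      + (2 * (1 - α) * l1 - 2 * β) * (2 * β - 2 * l2)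
      + 2 * β ^ 2 * (2 * (1 - α) * l1 - 2 * β)
      - ((α - β) * (2 * threeB α β m1 l1 l2 - (α - β) * shiftY α β l1 m1 l2)
        + 2 * β * (2 * (1 - α) * l1 - 2 * β))
      - 2 * β * ((α - β) * ((2 * β + threeA α β m1 l1 m2 l2 + threeC α β m1 l1
            - (α - β) / 2 * shiftX α β l1 m1)
          + (2 * β + threeB α β m1 l1 l2 + (α - β) / 2 * (2 + shiftY α β l1 m1 l2))
          + (threeC α β m1 l1 + (α - β) / 2 * shiftX α β l1 m1)) - 4 * ((α - β) * β / 2)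
        - 2 * (l1 - β - β * l1 + (α - β) * (β - l1)) + β * (2 * (1 - α) * l1 - 2 * β))
      - 2 * ((α - β) * (threeC α β m1 l1 + (α - β) / 2 * shiftX α β l1 m1)
        - 2 * ((α - β) * β / 2)) * threeA α β l1 m1 l2 m2
      - (α - β) * ((2 + 2 * threeS α β m1 l1 l2) - 4) * (l1 - β - β * l1 + (α - β) * (β - l1))
      - ((α - β) * (-2 * (4 * α / (α - 4 * β))) + 2 * (2 * (1 - α) * l1 - 2 * β))
        * (l2 - β - β * l2 + (α - β) * (β - l2))
      - (α - β) * (2 * threeD α β m1 l1) * coefA α β l1 m1 l2)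
  obtain ⟨q₁, q₂, q₃, e⟩ := h.axis₀.exists_four_smul_s_mul_s02 (h.tau₀_add 1) (h.tau₀_add 2)
    h.phi₀_add_one h.phi₀_add_two rfl rfl (h.zero_mul_add 1) (h.zero_mul_add 2)
    (h.zero_mul_add 3) (h.zero_mul_s hchar) (h.zero_mul_s02 hchar)
    (h.zero_mul_s12 hchar hαβ h2β) (h.add_two_mul_s hchar) (h.add_one_mul_s02 hchar hαβ h2β)
    (h.s03_eq hchar hαβ h2β hβ h4β) (h.add_one_mul_add_two hchar hαβ h2β hβ h4β) hY0.symm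
    (prodB_eq hchar hβ hαβ h2β h4β rfl rfl rfl rfl rfl rfl)
    (prodC_eq hchar hβ hαβ h2β h4β rfl rfl rfl rfl rfl rfl rfl)
    (prodD_eq hchar hβ hαβ h2β h4β rfl rfl)
  have hA := polyA_eq hchar hβ hαβ h2β h4β l1 m1 l2 m2
  have hB := polyB_eq hchar hβ hαβ h2β h4β rfl rfl rfl rfl rfl rfl rfl rfl rfl rfl rfl rfl
    hY0.symm
  rw [hA, hB]
  clear hA hB hY0
  have e' := congrArg τ₁ e
  have f₄ := h.shift_two hchar hαβ h2β hβ h4β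
  have f₃ := h.flip.shift_two hchar hαβ h2β hβ h4β
  simp only [show (1 : ℤ) - 0 = 1 by norm_num, show (1 : ℤ) - 2 = -1 by norm_num,
    show (1 : ℤ) - 3 = -2 by norm_num, show (1 : ℤ) - 4 = -3 by norm_num,
    show (1 : ℤ) - -1 = 2 by norm_num, show (1 : ℤ) - -2 = 3 by norm_num] at f₃
  have f₅ := congrArg τ₁ f₃
  simp only [h.axis₁.tau_mul, map_add, map_sub, map_smul, h.tau₁_sv_zero_one, h.tau₁_sv_zero_two,
    h.tau₁_sv_one_neg_one, h.tau₁, sub_zero, sub_self, show (2 : ℤ) - 1 = 1 by norm_num,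
    show (2 : ℤ) - 3 = -1 by norm_num, show (2 : ℤ) - -3 = 5 by norm_num,
    show (2 : ℤ) - -1 = 3 by norm_num, show (2 : ℤ) - -2 = 4 by norm_num] at e' f₅
  generalize α ^ 2 * (α - β) ^ 2 / (2 ^ 2 * (α - 2 * β)) = Y3 at *
  generalize prodB α β l1 m1 l2 m2 = Y1 at *
  generalize prodC α β l1 m1 = Y2 at *
  generalize shiftX α β l1 m1 = x at *
  generalize shiftY α β l1 m1 l2 = y at *
  generalize shiftX α β m1 l1 = x' at *
  generalize shiftY α β m1 l1 m2 = y' at *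
  refine smul_right_injective V h4 ?_
  dsimp only
  generalize (α - 4 * β) ^ 2 = d
  linear_combination (norm := module) (2 * d) • e - (2 * d) • e'
    - (8 * d * (Y2 + Y3 * x')) • f₄ + (8 * d * Y3) • f₃ - (8 * d * Y3) • f₅

end Frame

end Axial

namespace Axial

section Sequence

variable {F : Type*} [Field F] {V : Type*} [NonUnitalNonAssocCommRing V] [Module F V]

theorem axSeq_two_mul (a₀ a₁ : V) (τ₀ τ₁ : V ≃ₗ[F] V) (k : ℤ) :
    axSeq F a₀ a₁ τ₀ τ₁ (2 * k) = ((τ₁ * τ₀) ^ k) a₀ := by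
  rw [axSeq, if_pos (by omega), show 2 * k / 2 = k by omega]

theorem axSeq_two_mul_add_one (a₀ a₁ : V) (τ₀ τ₁ : V ≃ₗ[F] V) (k : ℤ) :
    axSeq F a₀ a₁ τ₀ τ₁ (2 * k + 1) = ((τ₁ * τ₀) ^ k) a₁ := by
  rw [axSeq, if_neg (by omega), show (2 * k + 1 - 1) / 2 = k by omega]

theorem tau₀_zpow {τ₀ τ₁ : V ≃ₗ[F] V} (h₀ : τ₀ * τ₀ = 1) (h₁ : τ₁ * τ₁ = 1) (k : ℤ) :
    τ₀ * (τ₁ * τ₀) ^ k = (τ₁ * τ₀) ^ (-k) * τ₀ := by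
  have i₀ : τ₀⁻¹ = τ₀ := inv_eq_of_mul_eq_one_left h₀
  have i₁ : τ₁⁻¹ = τ₁ := inv_eq_of_mul_eq_one_left h₁
  have e : SemiconjBy τ₀ (τ₁ * τ₀) (τ₁ * τ₀)⁻¹ := by
    rw [SemiconjBy, mul_inv_rev, i₀, i₁, mul_assoc]
  have := (e.zpow_right k).eq
  rwa [inv_zpow, ← zpow_neg] at this

theorem tau₀_axSeq {a₀ a₁ : V} {τ₀ τ₁ : V ≃ₗ[F] V} (h₀ : τ₀ * τ₀ = 1) (h₁ : τ₁ * τ₁ = 1)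
    (ha₀ : τ₀ a₀ = a₀) (ha₁ : τ₁ a₁ = a₁) (i : ℤ) :
    τ₀ (axSeq F a₀ a₁ τ₀ τ₁ i) = axSeq F a₀ a₁ τ₀ τ₁ (-i) := by
  have key (k : ℤ) (x : V) : τ₀ (((τ₁ * τ₀) ^ k) x) = ((τ₁ * τ₀) ^ (-k)) (τ₀ x) := by
    rw [← LinearEquiv.mul_apply, tau₀_zpow h₀ h₁, LinearEquiv.mul_apply]
  obtain ⟨k, rfl | rfl⟩ := Int.even_or_odd' i
  · rw [← mul_neg, axSeq_two_mul, axSeq_two_mul, key, ha₀]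
  · have e : ((τ₁ * τ₀) ^ (-1 : ℤ)) a₁ = τ₀ a₁ := by
      have i₀ : τ₀⁻¹ = τ₀ := inv_eq_of_mul_eq_one_left h₀
      have i₁ : τ₁⁻¹ = τ₁ := inv_eq_of_mul_eq_one_left h₁
      rw [zpow_neg_one, mul_inv_rev, i₀, i₁, LinearEquiv.mul_apply, ha₁]
    rw [show -(2 * k + 1) = 2 * (-k + -1) + 1 by ring, axSeq_two_mul_add_one,
      axSeq_two_mul_add_one, key, zpow_add, LinearEquiv.mul_apply, e]

theorem tau₁_axSeq {a₀ a₁ : V} {τ₀ τ₁ : V ≃ₗ[F] V} (h₀ : τ₀ * τ₀ = 1) (h₁ : τ₁ * τ₁ = 1)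
    (ha₀ : τ₀ a₀ = a₀) (ha₁ : τ₁ a₁ = a₁) (i : ℤ) :
    τ₁ (axSeq F a₀ a₁ τ₀ τ₁ i) = axSeq F a₀ a₁ τ₀ τ₁ (2 - i) := by
  have e (x : V) : τ₁ x = (τ₁ * τ₀) (τ₀ x) := by
    rw [← LinearEquiv.mul_apply, mul_assoc, h₀, mul_one]
  have key (k : ℤ) (x : V) : (τ₁ * τ₀) (((τ₁ * τ₀) ^ k) x) = ((τ₁ * τ₀) ^ (1 + k)) x := by
    rw [← LinearEquiv.mul_apply, zpow_one_add]
  rw [e, tau₀_axSeq h₀ h₁ ha₀ ha₁]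
  obtain ⟨k, rfl | rfl⟩ := Int.even_or_odd' i
  · rw [← mul_neg, show 2 - 2 * k = 2 * (1 + -k) by ring, axSeq_two_mul, axSeq_two_mul, key]
  · rw [show -(2 * k + 1) = 2 * (-k + -1) + 1 by ring,
      show 2 - (2 * k + 1) = 2 * (1 + (-k + -1)) + 1 by ring, axSeq_two_mul_add_one,
      axSeq_two_mul_add_one, key]

end Sequence
end Axial

theorem lemma_s1s2 {F : Type*} [Field F] {V : Type*} [NonUnitalNonAssocCommRing V]
    [Module F V] [SMulCommClass F V V] [IsScalarTower F V V] {α β : F}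
    (hchar : (2 : F) ≠ 0)
    (hα0 : α ≠ 0) (hα1 : α ≠ 1) (hβ0 : β ≠ 0) (hβ1 : β ≠ 1) (hαβ : α ≠ β)
    (h2β : α ≠ 2 * β) (h4β : α ≠ 4 * β)
    {a₀ a₁ : V} (hV : Axial.IsTwoGenerated F α β a₀ a₁)
    (τ₀ τ₁ : V ≃ₗ[F] V)
    (hτ₀ : Axial.IsMiyamoto F α β a₀ τ₀) (hτ₁ : Axial.IsMiyamoto F α β a₁ τ₁)
    (a : ℤ → V) (ha : a = Axial.axSeq F a₀ a₁ τ₀ τ₁)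
    (l1 l1f l2 l2f : F)
    (hl1 : Axial.HasProj F α β a₀ (a 1) l1) (hl1f : Axial.HasProj F α β a₁ (a 0) l1f)
    (hl2 : Axial.HasProj F α β a₀ (a 2) l2) (hl2f : Axial.HasProj F α β a₁ (a (-1)) l2f) :
    Axial.polyA α β l1 l1f l2 l2f • (a (-2) - a 2)
      = (2 / (β * (α - β)) * Axial.polyB α β l1 l1f l2 l2f) • (a (-1) - a 1) ∧
    Axial.polyA α β l1f l1 l2f l2 • (a 3 - a (-1))
      = (2 / (β * (α - β)) * Axial.polyB α β l1f l1 l2f l2) • (a 2 - a 0) := by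
  have s₀ := hτ₀.apply_self hV.axis₀
  have s₁ := hτ₁.apply_self hV.axis₁
  have i₀ : τ₀ * τ₀ = 1 := LinearEquiv.ext (hτ₀.apply_apply hV.axis₀)
  have i₁ : τ₁ * τ₁ = 1 := LinearEquiv.ext (hτ₁.apply_apply hV.axis₁)
  have z₀ : a 0 = a₀ := by rw [ha, ← mul_zero 2, Axial.axSeq_two_mul]; simp
  have z₁ : a 1 = a₁ := by
    rw [ha, show (1 : ℤ) = 2 * 0 + 1 by norm_num, Axial.axSeq_two_mul_add_one]; simp
  have t₀ (i : ℤ) : τ₀ (a i) = a (-i) := by rw [ha, Axial.tau₀_axSeq i₀ i₁ s₀ s₁]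
  have t₁ (i : ℤ) : τ₁ (a i) = a (2 - i) := by rw [ha, Axial.tau₁_axSeq i₀ i₁ s₀ s₁]
  clear ha
  subst z₀ z₁
  by_cases h₀ : a 0 = 0
  · have e₀ (i : ℤ) : a (-i) = a i := by rw [← t₀, hτ₀.apply_of_eq_zero h₀]
    have e₂ : a 2 = 0 := by rw [← sub_zero (2 : ℤ), ← t₁, h₀, map_zero]
    have e₃ : a 3 = a 1 := by
      rw [show (3 : ℤ) = 2 - -1 by norm_num, ← t₁, e₀, s₁]
    simp [e₀, e₂, e₃, h₀]
  by_cases h₁ : a 1 = 0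
  · have e₁ (i : ℤ) : a (2 - i) = a i := by rw [← t₁, hτ₁.apply_of_eq_zero h₁]
    have e₂ : a 2 = a 0 := by rw [← sub_zero (2 : ℤ), e₁]
    have e₃ : a 3 = a (-1) := by rw [show (3 : ℤ) = 2 - -1 by norm_num, e₁]
    have e₄ : a (-2) = a 0 := by rw [← t₀, e₂, s₀]
    have e₅ : a (-1) = 0 := by rw [← t₀, h₁, map_zero]
    simp [e₂, e₃, e₄, e₅, h₁]
  obtain ⟨φ₀, f₀, p₀⟩ := hV.axis₀.exists_frame hchar hα1 hβ1 hτ₀ h₀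
  obtain ⟨φ₁, f₁, p₁⟩ := hV.axis₁.exists_frame hchar hα1 hβ1 hτ₁ h₁
  have h : Axial.Frame α β l1 l1f l2 l2f a τ₀ τ₁ φ₀ φ₁ :=
    ⟨f₀, f₁, t₀, t₁, p₀ _ _ hl1, p₀ _ _ hl2, p₁ _ _ hl1f, p₁ _ _ hl2f⟩
  have hαβ' := sub_ne_zero.2 hαβ
  have h2β' := sub_ne_zero.2 h2β
  have h4β' := sub_ne_zero.2 h4β
  exact ⟨h.flip.polyA_smul hchar hαβ' h2β' hβ0 h4β', h.polyA_smul hchar hαβ' h2β' hβ0 h4β'⟩
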